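/- arXiv:2401.07919 — 2 statements merged into one kernel-verified Lean document; each statement's English description precedes it below -/
import Mathlib

section
/- Let K be a simplicial complex on [m] with |K| path-connected, K_i a simplicial complex on [n_i], and v_i ∈ K a vertex, regarded as the first vertex of star_K(v_i). Then the geometric realization of K⟨•,…,•,K_i,•,…,•⟩ (with K_i substituted at v_i) is homotopy equivalent to the wedge (|K|, v_i) ∨ (|star_K(v_i)⟨K_i,•,…,•⟩|, v_i), where in the wedge v_i denotes the corresponding vertex point of each realization. -/
/-- An (abstract) simplicial complex on a vertex type `V`: a collection of finite
subsets of `V` (simplices) containing the empty set and closed under taking subsets. -/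
def IsComplex {V : Type*} (K : Set (Finset V)) : Prop :=
  ∅ ∈ K ∧ ∀ σ ∈ K, ∀ τ ⊆ σ, τ ∈ K

/-- For a finite set `σ` of vertices of the disjoint union `{(i,j) : i ∈ ι, j ∈ [n i]}`,
its `i`-th component `σ_i = {j : (i,j) ∈ σ}`. -/
def projC {ι : Type*} [DecidableEq ι] {n : ι → ℕ}
    (σ : Finset ((i : ι) × Fin (n i))) (i : ι) : Finset (Fin (n i)) :=
  Finset.univ.filter fun j => (⟨i, j⟩ : (i : ι) × Fin (n i)) ∈ σ

/-- The support `{i : σ_i ≠ ∅}` of a finite set of vertices of the disjoint union. -/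
def suppC {ι : Type*} [Fintype ι] [DecidableEq ι] {n : ι → ℕ}
    (σ : Finset ((i : ι) × Fin (n i))) : Finset ι :=
  Finset.univ.filter fun i => (projC σ i).Nonempty

/-- The substitution complex `K⟨K_1,…,K_m⟩`: the simplicial complex on the vertex set
`{(i,j) : i ∈ ι, j ∈ [n i]}` whose simplices are the sets `σ` with `supp σ ∈ K` and
`σ_i ∈ Ks i` for every `i`. -/
def substC {ι : Type*} [Fintype ι] [DecidableEq ι] {n : ι → ℕ}
    (K : Set (Finset ι)) (Ks : ∀ i, Set (Finset (Fin (n i)))) :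
    Set (Finset ((i : ι) × Fin (n i))) :=
  {σ | suppC σ ∈ K ∧ ∀ i, projC σ i ∈ Ks i}

open ContinuousMap

/-- The geometric realization `|K|` of a simplicial complex `K` on a finite vertex set
`V`: the subspace of `ℝ^V` of functions `f : V → [0,1]` with `∑ v, f v = 1` whose support
`{v : f v ≠ 0}` is a simplex of `K`. -/
def geomReal {V : Type*} [Fintype V] (K : Set (Finset V)) : Set (V → ℝ) :=
  {f | (∀ v, f v ∈ Set.Icc (0 : ℝ) 1) ∧ ∑ v, f v = 1 ∧
    (Finset.univ.filter fun v => f v ≠ 0) ∈ K}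

/-- The wedge `(X, x) ∨ (Y, y)` of two pointed topological spaces: the quotient of the
disjoint union `X ⊔ Y` obtained by identifying `x` with `y`. -/
def Wedge (X Y : Type*) [TopologicalSpace X] [TopologicalSpace Y] (x : X) (y : Y) :=
  Quot fun a b : X ⊕ Y => a = Sum.inl x ∧ b = Sum.inr y

instance (X Y : Type*) [TopologicalSpace X] [TopologicalSpace Y] (x : X) (y : Y) :
    TopologicalSpace (Wedge X Y x y) :=
  inferInstanceAs (TopologicalSpace (Quot _))


open unitInterval in
theorem wedge_equiv_aux {X P Q : Type*} [TopologicalSpace X] [TopologicalSpace P]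
    [TopologicalSpace Q] (i : P → X) (hi : Topology.IsClosedEmbedding i) (j : Q → X)
    (hj : Topology.IsClosedEmbedding j) (p : P) (q : Q) (hpq : i p = j q)
    (hcov : ∀ x, x ∈ Set.range i ∨ x ∈ Set.range j)
    (H : I × X → X) (Hcont : Continuous H) (H0 : ∀ x, H (0, x) = x)
    (Hi : ∀ t y, H (t, i y) ∈ Set.range i) (Hj : ∀ t y, H (t, j y) ∈ Set.range j)
    (Hc : ∀ t, H (t, i p) = i p)
    (H1 : ∀ x, x ∈ Set.range i → x ∈ Set.range j → H (1, x) = i p) :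
    Nonempty (X ≃ₕ Wedge P Q p q) := by
  choose HP hHP using Hi
  choose HQ hHQ using Hj
  have cP : Continuous (fun z : P × I => HP z.2 z.1) := by
    rw [hi.isEmbedding.continuous_iff]
    have : (i ∘ fun z : P × I => HP z.2 z.1) = fun z => H (z.2, i z.1) := by
      funext z; exact hHP _ _
    rw [this]
    have := hi.continuous
    fun_prop
  have cQ : Continuous (fun z : Q × I => HQ z.2 z.1) := by
    rw [hj.isEmbedding.continuous_iff]
    have : (j ∘ fun z : Q × I => HQ z.2 z.1) = fun z => H (z.2, j z.1) := by
      funext z; exact hHQ _ _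
    rw [this]
    have := hj.continuous
    fun_prop
  have P0 : ∀ y, HP 0 y = y := fun y => hi.injective (by rw [hHP, H0])
  have Q0 : ∀ y, HQ 0 y = y := fun y => hj.injective (by rw [hHQ, H0])
  have Pc : ∀ t, HP t p = p := fun t => hi.injective (by rw [hHP, Hc])
  have Qc : ∀ t, HQ t q = q := fun t => hj.injective (by rw [hHQ, ← hpq, Hc])
  let mk : P ⊕ Q → Wedge P Q p q := Quot.mk _
  have cmk : Continuous mk := continuous_quot_mk
  have mkeq : mk (Sum.inl p) = mk (Sum.inr q) := Quot.sound ⟨rfl, rfl⟩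
  -- quotient map
  have cE : Continuous (Sum.elim i j) := hi.continuous.sumElim hj.continuous
  have sE : Function.Surjective (Sum.elim i j) := by
    intro x
    rcases hcov x with ⟨y, hy⟩ | ⟨y, hy⟩
    · exact ⟨Sum.inl y, hy⟩
    · exact ⟨Sum.inr y, hy⟩
  have clE : IsClosedMap (Sum.elim i j) := by
    intro s hs
    have : Sum.elim i j '' s = i '' (Sum.inl ⁻¹' s) ∪ j '' (Sum.inr ⁻¹' s) := by
      ext x; simp
    rw [this]
    rw [isClosed_sum_iff] at hs
    exact (hi.isClosedMap _ hs.1).union (hj.isClosedMap _ hs.2)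
  have qE : Topology.IsQuotientMap (Sum.elim i j) := clE.isQuotientMap cE sE
  let F : P ⊕ Q → Wedge P Q p q :=
    Sum.elim (fun y => mk (Sum.inl (HP 1 y))) (fun y => mk (Sum.inr (HQ 1 y)))
  have cF : Continuous F := by
    refine Continuous.sumElim ?_ ?_
    · exact cmk.comp (continuous_inl.comp (cP.comp (by fun_prop : Continuous fun y : P => (y, (1:I)))))
    · exact cmk.comp (continuous_inr.comp (cQ.comp (by fun_prop : Continuous fun y : Q => (y, (1:I)))))
  have key : ∀ y z, i y = j z → mk (Sum.inl (HP 1 y)) = mk (Sum.inr (HQ 1 z)) := by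
    intro y z h
    have h1 : HP 1 y = p := hi.injective (by rw [hHP, H1 _ ⟨y, rfl⟩ ⟨z, h.symm⟩])
    have h2 : HQ 1 z = q := hj.injective (by rw [hHQ, H1 _ ⟨y, h⟩ ⟨z, rfl⟩, hpq])
    rw [h1, h2, mkeq]
  have compat : ∀ a b, Sum.elim i j a = Sum.elim i j b → F a = F b := by
    rintro (a | a) (b | b) h
    · rw [hi.injective h]
    · exact key a b h
    · exact (key b a h.symm).symm
    · rw [hj.injective h]
  choose s hs using sE
  let f : X → Wedge P Q p q := fun x => F (s x)
  have fE : ∀ a, f (Sum.elim i j a) = F a := fun a => compat _ _ (hs _)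
  have cf : Continuous f := by
    rw [qE.continuous_iff]
    have : f ∘ Sum.elim i j = F := funext fE
    rwa [this]
  let g : Wedge P Q p q → X := Quot.lift (Sum.elim i j) (by
    rintro a b ⟨rfl, rfl⟩; exact hpq)
  have cg : Continuous g := continuous_quot_lift _ cE
  have gmk : ∀ a, g (mk a) = Sum.elim i j a := fun a => rfl
  -- homotopy on the wedge
  let gp : C(P, C(I, Wedge P Q p q)) :=
    ContinuousMap.curry ⟨fun z : P × I => mk (Sum.inl (HP z.2 z.1)),
      cmk.comp (continuous_inl.comp cP)⟩
  let gq : C(Q, C(I, Wedge P Q p q)) :=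
    ContinuousMap.curry ⟨fun z : Q × I => mk (Sum.inr (HQ z.2 z.1)),
      cmk.comp (continuous_inr.comp cQ)⟩
  let G : Wedge P Q p q → C(I, Wedge P Q p q) := Quot.lift (Sum.elim gp gq) (by
    rintro a b ⟨rfl, rfl⟩
    ext t
    change mk (Sum.inl (HP t p)) = mk (Sum.inr (HQ t q))
    rw [Pc, Qc, mkeq])
  have cG : Continuous G := continuous_quot_lift _ (gp.continuous.sumElim gq.continuous)
  have cG' : Continuous fun z : I × Wedge P Q p q => G z.2 z.1 := by fun_prop
  have gf : ∀ x, g (f x) = H (1, x) := by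
    intro x
    have hx := hs x
    rw [← hx, fE]
    rcases s x with a | a
    · exact hHP _ _
    · exact hHQ _ _
  refine ⟨⟨⟨f, cf⟩, ⟨g, cg⟩, ?_, ?_⟩⟩
  · refine (ContinuousMap.Homotopic.symm ⟨⟨⟨H, Hcont⟩, ?_, ?_⟩⟩)
    · intro x; exact H0 x
    · intro x; exact (gf x).symm
  · refine (ContinuousMap.Homotopic.symm ⟨⟨⟨fun z => G z.2 z.1, cG'⟩, ?_, ?_⟩⟩)
    · intro x
      induction x using Quot.ind with
      | mk a =>
      rcases a with a | a
      · change mk (Sum.inl (HP 0 a)) = mk (Sum.inl a)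
        rw [P0]
      · change mk (Sum.inr (HQ 0 a)) = mk (Sum.inr a)
        rw [Q0]
    · intro x
      induction x using Quot.ind with
      | mk a =>
      change _ = f (Sum.elim i j a)
      rw [fE]
      rcases a with a | a
      · rfl
      · rfl

theorem mem_geomReal_of {V : Type*} [Fintype V] {K : Set (Finset V)} (hK : IsComplex K)
    {f : V → ℝ} (h0 : ∀ v, 0 ≤ f v) (h1 : ∑ v, f v = 1) (σ : Finset V) (hσ : σ ∈ K)
    (h : ∀ v, f v ≠ 0 → v ∈ σ) : f ∈ geomReal K := by
  refine ⟨fun v => ⟨h0 v, ?_⟩, h1, hK.2 σ hσ _ ?_⟩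
  · rw [← h1]
    exact Finset.single_le_sum (fun w _ => h0 w) (Finset.mem_univ v)
  · intro v hv
    exact h v (by simpa using hv)

theorem geomReal_mono {V : Type*} [Fintype V] {K K' : Set (Finset V)} (h : K ⊆ K') :
    geomReal K ⊆ geomReal K' := fun _ hf => ⟨hf.1, hf.2.1, h hf.2.2⟩

theorem isCompact_geomReal {V : Type*} [Fintype V] {K : Set (Finset V)} (hK : IsComplex K) :
    IsCompact (geomReal K) := by
  have hb : IsCompact (Set.pi Set.univ fun _ : V => Set.Icc (0 : ℝ) 1) :=
    isCompact_univ_pi fun _ => isCompact_Icc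
  refine hb.of_isClosed_subset ?_ ?_
  · have : geomReal K = ⋃ σ ∈ K, {f : V → ℝ | (∀ v, 0 ≤ f v) ∧ ∑ v, f v = 1 ∧
        ∀ v, v ∉ σ → f v = 0} := by
      ext f
      simp only [Set.mem_iUnion, Set.mem_ofPred_eq, exists_prop]
      constructor
      · intro h
        refine ⟨_, h.2.2, fun v => (h.1 v).1, h.2.1, ?_⟩
        intro v hv
        simpa using hv
      · rintro ⟨σ, hσ, h0, h1, h2⟩
        exact mem_geomReal_of hK h0 h1 σ hσ fun v hv => by
          by_contra hc; exact hv (h2 v hc)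
    rw [this]
    refine Set.Finite.isClosed_biUnion (Set.toFinite K) ?_
    intro σ _
    have e : {f : V → ℝ | (∀ v, 0 ≤ f v) ∧ ∑ v, f v = 1 ∧ ∀ v, v ∉ σ → f v = 0} =
      (⋂ v, {f : V → ℝ | 0 ≤ f v}) ∩ ({f | ∑ v, f v = 1} ∩
        ⋂ v, ⋂ (_ : v ∉ σ), {f | f v = 0}) := by
      ext f; simp
    rw [e]
    refine (isClosed_iInter fun v => isClosed_le (by fun_prop) (by fun_prop)).inter
      ((isClosed_eq (by fun_prop) (by fun_prop)).inter
        (isClosed_iInter fun v => isClosed_iInter fun _ => isClosed_eq (by fun_prop) (by fun_prop)))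
  · intro f hf v _
    exact hf.1 v

theorem exists_dist {V : Type*} [Fintype V] [DecidableEq V] (C : Set (Finset V))
    (hC : IsComplex C) : ∃ d : (V → ℝ) → ℝ, Continuous d ∧ (∀ f, (∀ v, 0 ≤ f v) → 0 ≤ d f) ∧
      (∀ f ∈ geomReal C, d f = 0) ∧
      (∀ f, (∀ v, 0 ≤ f v) → ∃ σ ∈ C, ∀ v, d f < f v → v ∈ σ) := by
  classical
  let T : Finset (Finset V) := Finset.univ.filter (· ∈ C)
  have hT : T.Nonempty := ⟨∅, by simpa [T] using hC.1⟩
  let d : (V → ℝ) → ℝ := fun f => T.inf' hT (fun σ => ∑ v ∈ σᶜ, f v)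
  have hd0 : ∀ f : V → ℝ, (∀ v, 0 ≤ f v) → 0 ≤ d f := fun f hf =>
    Finset.le_inf' _ _ fun σ _ => Finset.sum_nonneg fun v _ => hf v
  refine ⟨d, ?_, hd0, ?_, ?_⟩
  · apply Continuous.finset_inf'_apply
    intro σ _
    fun_prop
  · intro f hf
    refine le_antisymm ?_ (hd0 f fun v => (hf.1 v).1)
    have hm : (Finset.univ.filter fun v => f v ≠ 0) ∈ T := by
      have := hf.2.2
      simp only [T, Finset.mem_filter, Finset.mem_univ, true_and]
      exact this
    refine (Finset.inf'_le _ hm).trans (le_of_eq ?_)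
    apply Finset.sum_eq_zero
    intro v hv
    simpa using hv
  · intro f hf
    obtain ⟨σ, hσ, he⟩ := Finset.exists_mem_eq_inf' hT (fun σ => ∑ v ∈ σᶜ, f v)
    refine ⟨σ, by simpa [T] using hσ, ?_⟩
    intro v hv
    by_contra hc
    have h1 : d f = ∑ v ∈ σᶜ, f v := he
    have h2 : f v ≤ ∑ v ∈ σᶜ, f v :=
      Finset.single_le_sum (fun w _ => hf w) (by simpa using hc)
    linarith

theorem exists_homotopy_aux {V : Type*} [Fintype V] [DecidableEq V] (C S : Set (Finset V))
    (hC : IsComplex C) (hS : IsComplex S) (hCS : C ⊆ S) (a : V)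
    (hcone : ∀ σ ∈ C, insert a σ ∈ C) :
    ∃ H : unitInterval × geomReal S → geomReal S, Continuous H ∧ (∀ x, H (0, x) = x) ∧
      (∀ R : Set (Finset V), IsComplex R → C ⊆ R → ∀ t x, x.1 ∈ geomReal R →
        (H (t, x)).1 ∈ geomReal R) ∧
      (∀ t x, (x.1 = fun v => if v = a then 1 else 0) → H (t, x) = x) ∧
      (∀ x, x.1 ∈ geomReal C → (H (1, x)).1 = fun v => if v = a then 1 else 0) := by
  obtain ⟨d, dc, d0, dC, dσ⟩ := exists_dist C hC
  have hN : (0 : ℝ) < Fintype.card V := by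
    have : Nonempty V := ⟨a⟩
    exact_mod_cast Fintype.card_pos
  obtain ⟨δ, hδ⟩ : ∃ δ : ℝ, δ = 1 / (2 * Fintype.card V) := ⟨_, rfl⟩
  have hδ0 : 0 < δ := by rw [hδ]; positivity
  let α : (V → ℝ) → ℝ := fun f => min (d f) δ
  let β : (V → ℝ) → ℝ := fun f => max 0 (1 - d f / δ)
  let t₁ : ℝ → ℝ := fun t => min 1 (2 * t)
  let t₂ : ℝ → ℝ := fun t => max 0 (2 * t - 1)
  let g : ℝ → (V → ℝ) → V → ℝ := fun t f v => if v = a then f a + t₂ t * β f else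
    max 0 (f v - t₁ t * α f - t₂ t * (f a + β f))
  let s : ℝ → (V → ℝ) → ℝ := fun t f => ∑ v, g t f v
  have αc : Continuous α := by fun_prop
  have βc : Continuous β := by fun_prop
  have gc : Continuous fun z : ℝ × (V → ℝ) => g z.1 z.2 := by
    apply continuous_pi
    intro v
    by_cases hv : v = a
    · simp only [g, hv, if_true, t₂]; fun_prop
    · simp only [g, hv, if_false, t₁, t₂]; fun_prop
  have sc : Continuous fun z : ℝ × (V → ℝ) => s z.1 z.2 := by
    simp only [s]
    refine continuous_finsetSum _ fun v _ => ?_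
    exact (continuous_apply v).comp gc
  have β0 : ∀ f, 0 ≤ β f := fun f => le_max_left _ _
  have t20 : ∀ t, 0 ≤ t₂ t := fun t => le_max_left _ _
  have α0 : ∀ f, (∀ v, 0 ≤ f v) → 0 ≤ α f := fun f hf => le_min (d0 f hf) hδ0.le
  have t10 : ∀ t, 0 ≤ t → 0 ≤ t₁ t := fun t ht => le_min (by norm_num) (by linarith)
  have g0 : ∀ t f, (∀ v, 0 ≤ f v) → ∀ v, 0 ≤ g t f v := by
    intro t f hf v
    simp only [g]
    split_ifs
    · have := hf a; have := mul_nonneg (t20 t) (β0 f); linarith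
    · exact le_max_left _ _
  have s0 : ∀ t f, 0 ≤ t → (∀ v, 0 ≤ f v) → ∑ v, f v = 1 → 0 < s t f := by
    intro t f ht hf h1
    have hpos : ∃ v, 0 < g t f v := by
      by_cases hA : 0 < f a + t₂ t * β f
      · exact ⟨a, by simpa [g] using hA⟩
      have hb := mul_nonneg (t20 t) (β0 f)
      have ha := hf a
      have hfa : f a = 0 := by linarith
      have hfb : t₂ t * β f = 0 := by linarith
      obtain ⟨v, hv⟩ : ∃ v, 2 * δ ≤ f v := by
        by_contra! hc
        have hne : (Finset.univ : Finset V).Nonempty := ⟨a, Finset.mem_univ _⟩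
        have := Finset.sum_lt_sum_of_nonempty hne (fun v _ => hc v)
        rw [h1] at this
        simp [hδ] at this
        field_simp at this
        linarith
      have hva : v ≠ a := by rintro rfl; linarith
      refine ⟨v, ?_⟩
      simp only [g, hva, if_false]
      apply lt_max_of_lt_right
      have h2 : t₁ t * α f ≤ 1 * δ :=
        mul_le_mul (min_le_left _ _) (min_le_right _ _) (α0 f hf) (by norm_num)
      rw [hfa, zero_add, hfb]
      linarith
    obtain ⟨v, hv⟩ := hpos
    exact Finset.sum_pos' (fun w _ => g0 t f hf w) ⟨v, Finset.mem_univ _, hv⟩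
  let h : ℝ → (V → ℝ) → V → ℝ := fun t f v => g t f v / s t f
  have hmem : ∀ R : Set (Finset V), IsComplex R → C ⊆ R → ∀ t f, 0 ≤ t → f ∈ geomReal R →
      h t f ∈ geomReal R := by
    intro R hR hCR t f ht hf
    have f0 : ∀ v, 0 ≤ f v := fun v => (hf.1 v).1
    have sp := s0 t f ht f0 hf.2.1
    have hsum : ∑ v, h t f v = 1 := by
      simp only [h]
      rw [← Finset.sum_div]
      exact div_self sp.ne'
    have h0 : ∀ v, 0 ≤ h t f v := fun v => div_nonneg (g0 t f f0 v) sp.le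
    have hg : ∀ v, h t f v ≠ 0 → g t f v ≠ 0 := by
      intro v hv hc; apply hv; simp only [h, hc, zero_div]
    by_cases hB : t₂ t * β f = 0
    · refine mem_geomReal_of hR h0 hsum _ hf.2.2 ?_
      intro v hv
      have hv := hg v hv
      simp only [Finset.mem_filter, Finset.mem_univ, true_and]
      intro hc
      apply hv
      simp only [g]
      split_ifs with hva
      · rw [← hva, hc, hB, zero_add]
      · rw [hc]
        apply max_eq_left
        have := mul_nonneg (t10 t ht) (α0 f f0)
        have := mul_nonneg (t20 t) (add_nonneg (f0 a) (β0 f))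
        linarith
    · obtain ⟨σ, hσ, hσ'⟩ := dσ f f0
      refine mem_geomReal_of hR h0 hsum _ (hCR (hcone σ hσ)) ?_
      intro v hv
      have hv := hg v hv
      rw [Finset.mem_insert]
      by_cases hva : v = a
      · exact Or.inl hva
      right
      apply hσ'
      have ht2 : t₂ t ≠ 0 := left_ne_zero_of_mul hB
      have hβ : β f ≠ 0 := right_ne_zero_of_mul hB
      have ht : 0 < 2 * t - 1 := by
        by_contra hc; exact ht2 (max_eq_left (by linarith))
      have ht1 : t₁ t = 1 := min_eq_left (by linarith)
      have hd : 0 < 1 - d f / δ := by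
        by_contra hc; exact hβ (max_eq_left (by linarith))
      have hd' : d f < δ := by
        rw [sub_pos, div_lt_one hδ0] at hd; exact hd
      have hα : α f = d f := min_eq_left hd'.le
      by_contra hc
      apply hv
      simp only [g, hva, if_false]
      apply max_eq_left
      have := mul_nonneg (t20 t) (add_nonneg (f0 a) (β0 f))
      rw [ht1, hα]
      linarith
  have ha1 : ∀ t f, (∀ v, v ≠ a → g t f v = 0) → s t f ≠ 0 →
      h t f = fun v => if v = a then 1 else 0 := by
    intro t f hz hs
    have hsa : s t f = g t f a := by
      simp only [s]
      exact Finset.sum_eq_single a (fun v _ hv => hz v hv) (by simp)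
    funext v
    by_cases hv : v = a
    · subst hv
      simp only [h, if_true]
      rw [hsa] at hs ⊢
      exact div_self hs
    · simp only [h, hv, if_false, hz v hv, zero_div]
  refine ⟨fun z => ⟨h z.1 z.2, hmem S hS hCS z.1 z.2 z.1.2.1 z.2.2⟩, ?_, ?_, ?_, ?_, ?_⟩
  · apply Continuous.subtype_mk
    apply continuous_pi
    intro v
    simp only [h]
    have c1 : Continuous fun z : unitInterval × geomReal S => ((z.1 : ℝ), (z.2 : V → ℝ)) := by fun_prop
    refine Continuous.div ((continuous_apply v).comp (gc.comp c1)) (sc.comp c1) ?_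
    intro z
    exact (s0 z.1 z.2 z.1.2.1 (fun v => (z.2.2.1 v).1) z.2.2.2.1).ne'
  · intro x
    apply Subtype.ext
    have hg : g 0 x.1 = x.1 := by
      funext v
      simp only [g, t₁, t₂]
      split_ifs with hv
      · simp [hv]
      · simpa using (x.2.1 v).1
    have hs : s 0 x.1 = 1 := by
      simp only [s, hg]; exact x.2.2.1
    funext v
    simp only [h, Set.Icc.coe_zero, hg, hs, div_one]
  · intro R hR hCR t x hx
    exact hmem R hR hCR t x.1 t.2.1 hx
  · intro t x hx
    apply Subtype.ext
    rw [hx]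
    have f0 : ∀ v, 0 ≤ x.1 v := fun v => (x.2.1 v).1
    refine ha1 t x.1 ?_ (s0 t _ t.2.1 f0 x.2.2.1).ne'
    intro v hv
    simp only [g, hv, if_false]
    apply max_eq_left
    have := mul_nonneg (t10 t t.2.1) (α0 _ f0)
    have := mul_nonneg (t20 t) (add_nonneg (f0 a) (β0 x.1))
    have : x.1 v = 0 := by rw [hx]; simp [hv]
    linarith
  · intro x hx
    have f0 : ∀ v, 0 ≤ x.1 v := fun v => (x.2.1 v).1
    refine ha1 1 _ ?_ (s0 1 _ (by norm_num) f0 x.2.2.1).ne'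
    intro v hv
    simp only [g, hv, if_false]
    apply max_eq_left
    have hd : d x.1 = 0 := dC _ hx
    have hβ : β x.1 = 1 := by simp [β, hd]
    have hα : α x.1 = 0 := by simp [α, hd, hδ0.le]
    have ht2 : t₂ 1 = 1 := by norm_num [t₂]
    rw [hβ, hα, ht2]
    have := (x.2.1 v).2
    have := f0 a
    linarith

theorem mem_projC_iff {ι : Type*} [DecidableEq ι] {n : ι → ℕ}
    (σ : Finset ((i : ι) × Fin (n i))) (i : ι) (j : Fin (n i)) :
    j ∈ projC σ i ↔ (⟨i, j⟩ : (i : ι) × Fin (n i)) ∈ σ := by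
  simp [projC]

theorem mem_suppC_iff {ι : Type*} [Fintype ι] [DecidableEq ι] {n : ι → ℕ}
    (σ : Finset ((i : ι) × Fin (n i))) (i : ι) :
    i ∈ suppC σ ↔ ∃ j, (⟨i, j⟩ : (i : ι) × Fin (n i)) ∈ σ := by
  simp [suppC, Finset.Nonempty, mem_projC_iff]

theorem isComplex_substC {ι : Type*} [Fintype ι] [DecidableEq ι] {n : ι → ℕ}
    {K : Set (Finset ι)} {Ks : ∀ i, Set (Finset (Fin (n i)))} (hK : IsComplex K)
    (hKs : ∀ i, IsComplex (Ks i)) : IsComplex (substC K Ks) := by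
  constructor
  · constructor
    · convert hK.1
      ext i; simp [mem_suppC_iff]
    · intro i
      convert (hKs i).1
      ext j; simp [mem_projC_iff]
  · rintro σ ⟨h1, h2⟩ τ hτ
    constructor
    · refine hK.2 _ h1 _ ?_
      intro i
      rw [mem_suppC_iff, mem_suppC_iff]
      rintro ⟨j, hj⟩
      exact ⟨j, hτ hj⟩
    · intro i
      refine (hKs i).2 _ (h2 i) _ ?_
      intro j
      rw [mem_projC_iff, mem_projC_iff]
      exact fun h => hτ h

/-- let `K` be a simplicial complex on `[m]` with path-connected geometric
realization, `L` a simplicial complex on `[k]`, and `v₀` a vertex of `K`, regarded as the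
first vertex of `star_K(v₀)`. Then the geometric realization of the substitution complex
`K⟨•,…,•,L,•,…,•⟩` (with `L` substituted at `v₀`, encoded by block sizes `n'` with
`n' v₀ = k`, `n' v = 1` otherwise, and the family `B` with `B v₀ = L` transported along
`finCongr` and `B v = •` otherwise) is homotopy equivalent to the wedge
`(|K|, v₀) ∨ (|star_K(v₀)⟨L,•,…,•⟩|, v₀)`, where `star_K(v₀) = {τ ∈ K : τ ∪ {v₀} ∈ K}`
(a complex on `[m]`), the base point `p` of `|K|` is the vertex point of `v₀`, and the
base point `q` of the star substitution is the vertex point of `(v₀, 1)` (the first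
vertex of the copy of `L`), with which `v₀` is identified. -/
theorem substitution_one_vertex_homotopy_wedge {m k : ℕ} [NeZero k]
    (K : Set (Finset (Fin m))) (hK : IsComplex K)
    (L : Set (Finset (Fin k))) (hL : IsComplex L)
    (v₀ : Fin m) (hv₀ : {v₀} ∈ K)
    (hconn : PathConnectedSpace ↥(geomReal K))
    (n' : Fin m → ℕ) (hn'v : n' v₀ = k) (hn'o : ∀ v, v ≠ v₀ → n' v = 1)
    (B : ∀ v, Set (Finset (Fin (n' v))))
    (hBv : ∀ σ : Finset (Fin (n' v₀)), σ ∈ B v₀ ↔ σ.map (finCongr hn'v).toEmbedding ∈ L)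
    (hBo : ∀ v, v ≠ v₀ → B v = Set.univ)
    (p : ↥(geomReal K))
    (hp : (p : Fin m → ℝ) = fun v => if v = v₀ then 1 else 0)
    (q : ↥(geomReal (substC {τ : Finset (Fin m) | τ ∈ K ∧ insert v₀ τ ∈ K} B)))
    (hq : (q : ((v : Fin m) × Fin (n' v)) → ℝ) =
      fun w => if w = ⟨v₀, Fin.cast hn'v.symm 0⟩ then 1 else 0) :
    Nonempty (↥(geomReal (substC K B)) ≃ₕ
      Wedge ↥(geomReal K)
        ↥(geomReal (substC {τ : Finset (Fin m) | τ ∈ K ∧ insert v₀ τ ∈ K} B)) p q) := by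
  let St : Set (Finset (Fin m)) := {τ : Finset (Fin m) | τ ∈ K ∧ insert v₀ τ ∈ K}
  let a : (v : Fin m) × Fin (n' v) := ⟨v₀, Fin.cast hn'v.symm 0⟩
  have haw : ∀ w : (v : Fin m) × Fin (n' v), w = a ↔ w.1 = v₀ ∧ w.2.val = 0 := by
    rintro ⟨v, j⟩
    constructor
    · intro h
      rw [h]; exact ⟨rfl, by simp [a]⟩
    · rintro ⟨h1, h2⟩
      dsimp only at h1 h2
      subst h1
      have : j = Fin.cast hn'v.symm 0 := Fin.ext (by simpa using h2)
      rw [this]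
  have hpos : ∀ v, 0 < n' v := by
    intro v
    by_cases h : v = v₀
    · rw [h, hn'v]; exact Nat.pos_of_ne_zero (NeZero.ne k)
    · rw [hn'o v h]; exact Nat.one_pos
  have hB : ∀ v, IsComplex (B v) := by
    intro v
    by_cases h : v = v₀
    · subst h
      constructor
      · rw [hBv]; simpa using hL.1
      · intro σ hσ τ hτ
        rw [hBv] at hσ ⊢
        exact hL.2 _ hσ _ (Finset.map_subset_map.2 hτ)
    · rw [hBo v h]; exact ⟨trivial, fun _ _ _ _ => trivial⟩
  have hSt : IsComplex St := by
    constructor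
    · exact ⟨hK.1, by simpa using hv₀⟩
    · rintro σ ⟨h1, h2⟩ τ hτ
      exact ⟨hK.2 _ h1 _ hτ, hK.2 _ h2 _ (Finset.insert_subset_insert _ hτ)⟩
  have hS : IsComplex (substC K B) := isComplex_substC hK hB
  have hQ : IsComplex (substC St B) := isComplex_substC hSt hB
  let P : Set (Finset ((v : Fin m) × Fin (n' v))) :=
    {σ | σ ∈ substC K B ∧ ∀ w ∈ σ, w.2.val = 0}
  have hP : IsComplex P := by
    constructor
    · exact ⟨hS.1, by simp⟩
    · rintro σ ⟨h1, h2⟩ τ hτ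
      exact ⟨hS.2 _ h1 _ hτ, fun w hw => h2 w (hτ hw)⟩
  have hQS : substC St B ⊆ substC K B := fun σ hσ => ⟨hσ.1.1, hσ.2⟩
  have hPS : P ⊆ substC K B := fun σ hσ => hσ.1
  have hcov : ∀ σ ∈ substC K B, σ ∈ P ∨ σ ∈ substC St B := by
    intro σ hσ
    by_cases h : v₀ ∈ suppC σ
    · right
      exact ⟨⟨hσ.1, by rw [Finset.insert_eq_of_mem h]; exact hσ.1⟩, hσ.2⟩
    · left
      refine ⟨hσ, ?_⟩
      rintro ⟨v, j⟩ hw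
      have hv : v ≠ v₀ := by
        rintro rfl
        exact h ((mem_suppC_iff _ _).2 ⟨j, hw⟩)
      have := j.2
      have := hn'o v hv
      dsimp only
      omega
  -- the first vertex of `L` is a genuine vertex
  have hzero : ∀ τ : Finset (Fin (n' v₀)), (∀ j ∈ τ, j.val = 0) → τ ∈ B v₀ := by
    intro τ hτ
    refine (hB v₀).2 _ (q.2.2.2.2 v₀) _ ?_
    intro j hj
    rw [mem_projC_iff]
    simp only [Finset.mem_filter, Finset.mem_univ, true_and]
    rw [hq]
    have : (⟨v₀, j⟩ : (v : Fin m) × Fin (n' v)) = ⟨v₀, Fin.cast hn'v.symm 0⟩ :=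
      (haw _).2 ⟨rfl, hτ j hj⟩
    simp [this]
  let C : Set (Finset ((v : Fin m) × Fin (n' v))) := P ∩ substC St B
  have hC : IsComplex C :=
    ⟨⟨hP.1, hQ.1⟩, fun σ hσ τ hτ => ⟨hP.2 σ hσ.1 τ hτ, hQ.2 σ hσ.2 τ hτ⟩⟩
  have hcone : ∀ σ ∈ C, insert a σ ∈ C := by
    rintro σ ⟨⟨h1, h2⟩, h3⟩
    have hz : ∀ w ∈ insert a σ, w.2.val = 0 := by
      intro w hw
      rcases Finset.mem_insert.1 hw with h | h
      · exact ((haw w).1 h).2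
      · exact h2 w h
    have hs : suppC (insert a σ) ⊆ insert v₀ (suppC σ) := by
      intro v hv
      obtain ⟨j, hj⟩ := (mem_suppC_iff _ _).1 hv
      rcases Finset.mem_insert.1 hj with h | h
      · exact Finset.mem_insert.2 (Or.inl ((haw _).1 h).1)
      · exact Finset.mem_insert_of_mem ((mem_suppC_iff _ _).2 ⟨j, h⟩)
    have hpr : ∀ v, projC (insert a σ) v ∈ B v := by
      intro v
      by_cases h : v = v₀
      · subst h
        apply hzero
        intro j hj
        exact hz _ ((mem_projC_iff _ _ _).1 hj)
      · rw [hBo v h]; trivial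
    have hk : insert v₀ (suppC σ) ∈ K := h3.1.2
    have hq' : insert a σ ∈ substC St B := by
      refine ⟨⟨hK.2 _ hk _ hs, hK.2 _ hk _ ?_⟩, hpr⟩
      exact Finset.insert_subset (Finset.mem_insert_self _ _) hs
    exact ⟨⟨hQS hq', hz⟩, hq'⟩
  -- embedding of `|K|`
  let e : (Fin m → ℝ) → ((v : Fin m) × Fin (n' v)) → ℝ :=
    fun x w => if w.2.val = 0 then x w.1 else 0
  have he : Continuous e := by
    apply continuous_pi
    intro w
    simp only [e]
    split_ifs <;> fun_prop
  have hesum : ∀ x, ∑ w, e x w = ∑ v, x v := by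
    intro x
    rw [Fintype.sum_sigma]
    refine Finset.sum_congr rfl fun v _ => ?_
    rw [Finset.sum_eq_single (⟨0, hpos v⟩ : Fin (n' v))]
    · simp [e]
    · intro j _ hj
      have : j.val ≠ 0 := fun h => hj (Fin.ext h)
      simp [e, this]
    · simp
  have hemem : ∀ x ∈ geomReal K, e x ∈ geomReal P := by
    intro x hx
    have h0 : ∀ v, 0 ≤ x v := fun v => (hx.1 v).1
    refine mem_geomReal_of hP ?_ ((hesum x).trans hx.2.1)
      (Finset.univ.filter fun w => e x w ≠ 0) ?_ (by simp)
    · intro w; simp only [e]; split_ifs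
      · exact h0 _
      · exact le_rfl
    have hz : ∀ w ∈ (Finset.univ.filter fun w => e x w ≠ 0), w.2.val = 0 := by
      intro w hw
      by_contra hc
      simp [e, hc] at hw
    refine ⟨⟨?_, ?_⟩, hz⟩
    · refine hK.2 _ hx.2.2 _ ?_
      intro v hv
      obtain ⟨j, hj⟩ := (mem_suppC_iff _ _).1 hv
      have h1 := hz _ hj
      simp only [Finset.mem_filter, Finset.mem_univ, true_and, e] at hj h1 ⊢
      rw [if_pos h1] at hj
      exact hj
    · intro v
      by_cases h : v = v₀
      · subst h
        apply hzero
        intro j hj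
        exact hz _ ((mem_projC_iff _ _ _).1 hj)
      · rw [hBo v h]; trivial
  let i : geomReal K → geomReal (substC K B) :=
    fun x => ⟨e x.1, geomReal_mono hPS (hemem x.1 x.2)⟩
  let j : geomReal (substC St B) → geomReal (substC K B) :=
    fun x => ⟨x.1, geomReal_mono hQS x.2⟩
  have : CompactSpace (geomReal K) := isCompact_iff_compactSpace.1 (isCompact_geomReal hK)
  have : CompactSpace (geomReal (substC St B)) :=
    isCompact_iff_compactSpace.1 (isCompact_geomReal hQ)
  have hi : Topology.IsClosedEmbedding i := by
    refine Continuous.isClosedEmbedding ?_ ?_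
    · exact (he.comp continuous_subtype_val).subtype_mk _
    · intro x y hxy
      apply Subtype.ext
      funext v
      have := congrFun (congrArg Subtype.val hxy) ⟨v, ⟨0, hpos v⟩⟩
      simpa [i, e] using this
  have hj : Topology.IsClosedEmbedding j := by
    refine Continuous.isClosedEmbedding ?_ ?_
    · exact continuous_subtype_val.subtype_mk _
    · intro x y hxy
      apply Subtype.ext
      have h : (j x).1 = (j y).1 := by rw [hxy]
      exact h
  have ri : ∀ x, x ∈ Set.range i ↔ x.1 ∈ geomReal P := by
    intro x
    constructor
    · rintro ⟨y, rfl⟩; exact hemem y.1 y.2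
    · intro hx
      let y : Fin m → ℝ := fun v => x.1 ⟨v, ⟨0, hpos v⟩⟩
      have hey : e y = x.1 := by
        funext w
        simp only [e, y]
        split_ifs with h
        · congr 1
          obtain ⟨v, l⟩ := w
          dsimp only at h
          have hl : (⟨0, hpos v⟩ : Fin (n' v)) = l := Fin.ext h.symm
          simp only [hl]
        · by_contra hc
          exact h (hx.2.2.2 w (by simpa using fun h => hc h.symm))
      have hy : y ∈ geomReal K := by
        refine mem_geomReal_of hK (fun v => (hx.1 _).1) ?_ _ hx.2.2.1.1 ?_
        · rw [← hesum, hey]; exact hx.2.1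
        · intro v hv
          rw [mem_suppC_iff]
          exact ⟨⟨0, hpos v⟩, by simpa using hv⟩
      exact ⟨⟨y, hy⟩, Subtype.ext hey⟩
  have rj : ∀ x, x ∈ Set.range j ↔ x.1 ∈ geomReal (substC St B) := by
    intro x
    constructor
    · rintro ⟨y, rfl⟩; exact y.2
    · intro hx; exact ⟨⟨x.1, hx⟩, rfl⟩
  have hip : (i p).1 = fun w => if w = a then 1 else 0 := by
    funext w
    simp only [i, e, hp, haw]
    by_cases h1 : w.1 = v₀ <;> by_cases h2 : w.2.val = 0 <;> simp [h1, h2]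
  have hjq : (j q).1 = fun w => if w = a then 1 else 0 := hq
  obtain ⟨H, Hc, H0, HR, Ha, H1⟩ := exists_homotopy_aux C (substC K B) hC hS
    (fun σ hσ => hPS hσ.1) a hcone
  refine wedge_equiv_aux i hi j hj p q (Subtype.ext (hip.trans hjq.symm)) ?_ H Hc H0 ?_ ?_ ?_ ?_
  · intro x
    rw [ri, rj]
    rcases hcov _ x.2.2.2 with h | h
    · exact Or.inl ⟨x.2.1, x.2.2.1, h⟩
    · exact Or.inr ⟨x.2.1, x.2.2.1, h⟩
  · intro t y
    rw [ri]
    exact HR P hP (fun σ hσ => hσ.1) t _ ((ri _).1 ⟨y, rfl⟩)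
  · intro t y
    rw [rj]
    exact HR _ hQ (fun σ hσ => hσ.2) t _ ((rj _).1 ⟨y, rfl⟩)
  · intro t
    exact Ha t _ hip
  · intro x hx hx'
    rw [ri] at hx
    rw [rj] at hx'
    apply Subtype.ext
    rw [hip]
    exact H1 x ⟨hx.1, hx.2.1, hx.2.2, hx'.2.2⟩
end

section
/- (Homotopy decomposition of substitution complexes.) Let K be a simplicial complex on [m] with |K| path-connected and let K_i be simplicial complexes on [n_i], i ∈ [m]. Define K^0 = K and, for 1 ≤ i ≤ m, K^i = K^{i-1}⟨•,…,•,K_i,•,…,•⟩, where K_i is substituted at the vertex v_i = v_{i,1} of K^{i-1} and • at all other vertices. Then the geometric realization of K⟨K_1,…,K_m⟩ is homotopy equivalent to the wedge |K| ∨ |link_{K^0}(v_1) * K_1| ∨ ⋯ ∨ |link_{K^{m-1}}(v_m) * K_m|. -/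
open ContinuousMap

/-- The link of a vertex `v` in a simplicial complex `S`:
`link_S(v) = {τ ∈ S : v ∉ τ, τ ∪ {v} ∈ S}`. -/
def linkC {V : Type*} [DecidableEq V] (S : Set (Finset V)) (v : V) : Set (Finset V) :=
  {τ | τ ∈ S ∧ v ∉ τ ∧ insert v τ ∈ S}

/-- The wedge `⋁ i, (X i, p i)` of a family of pointed topological spaces: the quotient
of the disjoint union `⊔ i, X i` obtained by identifying all the base points `p i`. -/
def WedgeFam {ι : Type*} (X : ι → Type*) [∀ i, TopologicalSpace (X i)] (p : ∀ i, X i) :=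
  Quot fun a b : (i : ι) × X i => (∃ i, a = ⟨i, p i⟩) ∧ ∃ j, b = ⟨j, p j⟩

instance {ι : Type*} (X : ι → Type*) [∀ i, TopologicalSpace (X i)] (p : ∀ i, X i) :
    TopologicalSpace (WedgeFam X p) :=
  inferInstanceAs (TopologicalSpace (Quot _))

/-- The family of spaces appearing in the wedge decomposition of Theorem 3.1: the member
at `none` is `|K|` and the member at `some i` is `|link_{K^{i-1}}(v_i) * K_i|`
(the realization of the complex `Z i`). -/
def OWedgeSpace {m : ℕ} {n : Fin m → ℕ} (K : Set (Finset (Fin m)))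
    (Z : Fin m → Set (Finset ((i : Fin m) × Fin (n i)))) : Option (Fin m) → Type :=
  fun o => Option.rec ↥(geomReal K) (fun i => ↥(geomReal (Z i))) o

instance {m : ℕ} {n : Fin m → ℕ} (K : Set (Finset (Fin m)))
    (Z : Fin m → Set (Finset ((i : Fin m) × Fin (n i)))) (o : Option (Fin m)) :
    TopologicalSpace (OWedgeSpace K Z o) :=
  match o with
  | none => inferInstanceAs (TopologicalSpace ↥(geomReal K))
  | some i => inferInstanceAs (TopologicalSpace ↥(geomReal (Z i)))


namespace SubstHE
open ContinuousMap
open scoped unitInterval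

def IsHE {X Y : Type} [TopologicalSpace X] [TopologicalSpace Y] (f : C(X, Y)) : Prop :=
  ∃ g : C(Y, X), (g.comp f).Homotopic (ContinuousMap.id X) ∧
    (f.comp g).Homotopic (ContinuousMap.id Y)

section basics
variable {X Y Z T : Type} [TopologicalSpace X] [TopologicalSpace Y] [TopologicalSpace Z]
  [TopologicalSpace T]

theorem IsHE.nonempty {f : C(X, Y)} (h : IsHE f) : Nonempty (X ≃ₕ Y) := by
  obtain ⟨g, h1, h2⟩ := h
  exact ⟨⟨f, g, h1, h2⟩⟩

theorem Homotopic.compL {f g : C(X, Y)} (k : C(Y, Z)) (h : f.Homotopic g) :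
    (k.comp f).Homotopic (k.comp g) := (Homotopic.refl k).comp h

theorem Homotopic.compR {f g : C(Y, Z)} (h : f.Homotopic g) (k : C(X, Y)) :
    (f.comp k).Homotopic (g.comp k) := h.comp (Homotopic.refl k)

theorem isHE_of_six (u : C(X, Y)) (w : C(Y, Z)) (k : C(Z, X))
    (l : C(Z, Y)) (hk : IsHE k)
    (h1 : ((k.comp w).comp u).Homotopic (ContinuousMap.id X))
    (h2 : (l.comp w).Homotopic (ContinuousMap.id Y)) : IsHE u := by
  obtain ⟨j, hj1, hj2⟩ := hk
  refine ⟨k.comp w, h1, ?_⟩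
  have e1 : (w.comp u).Homotopic j := by
    have a := Homotopic.compR hj1 (w.comp u)
    have b := Homotopic.compL j h1
    exact a.symm.trans b
  have e2 : ((w.comp u).comp k).Homotopic (ContinuousMap.id Z) :=
    (Homotopic.compR e1 k).trans hj1
  have e3 : (w.comp (u.comp (k.comp w))).Homotopic w := Homotopic.compR e2 w
  have e4 := Homotopic.compL l e3
  have e5 := Homotopic.compR h2 (u.comp (k.comp w))
  exact e5.symm.trans (e4.trans h2)

/-- curried homotopies -/
theorem homotopic_of_curried {f g : C(X, Y)} (D : C(X, C(I, Y))) (h0 : ∀ x, D x 0 = f x)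
    (h1 : ∀ x, D x 1 = g x) : f.Homotopic g :=
  ⟨{ toFun := fun q => D q.2 q.1
     continuous_toFun := by fun_prop
     map_zero_left := h0
     map_one_left := h1 }⟩

def homotopyOfCurried {f g : C(X, Y)} (D : C(X, C(I, Y))) (h0 : ∀ x, D x 0 = f x)
    (h1 : ∀ x, D x 1 = g x) : f.Homotopy g :=
   { toFun := fun q => D q.2 q.1
     continuous_toFun := by fun_prop
     map_zero_left := h0
     map_one_left := h1 }

def curryH {f g : C(X, Y)} (F : f.Homotopy g) : C(X, C(I, Y)) :=
  ContinuousMap.curry ⟨fun q : X × I => F (q.2, q.1), by fun_prop⟩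

theorem curryH_apply {f g : C(X, Y)} (F : f.Homotopy g) (x : X) (t : I) :
    curryH F x t = F (t, x) := rfl

end basics

/-- homotopy extension property for a point -/
def HEP (B : Type) [TopologicalSpace B] (b : B) : Prop :=
  ∀ (Y : Type) [TopologicalSpace Y] (g : C(B, Y)) (γ : C(I, Y)), γ 0 = g b →
    ∃ H : C(B, C(I, Y)), (∀ x, H x 0 = g x) ∧ H b = γ

/-- binary wedge -/
def Wd (A : Type) (a : A) (B : Type) (b : B) : Type :=
  Quot fun x y : A ⊕ B => x = Sum.inl a ∧ y = Sum.inr b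

section wd
variable {A B A' Y : Type} [TopologicalSpace A] [TopologicalSpace B] [TopologicalSpace A']
  [TopologicalSpace Y]

instance (a : A) (b : B) : TopologicalSpace (Wd A a B b) :=
  inferInstanceAs (TopologicalSpace (Quot _))

def wl (a : A) (b : B) : C(A, Wd A a B b) :=
  ⟨fun x => Quot.mk _ (Sum.inl x), continuous_quot_mk.comp continuous_inl⟩

def wr (a : A) (b : B) : C(B, Wd A a B b) :=
  ⟨fun x => Quot.mk _ (Sum.inr x), continuous_quot_mk.comp continuous_inr⟩

theorem wlr (a : A) (b : B) : wl a b a = wr a b b := Quot.sound ⟨rfl, rfl⟩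

def wdesc {a : A} {b : B} (f : C(A, Y)) (g : C(B, Y)) (h : f a = g b) : C(Wd A a B b, Y) :=
  ⟨Quot.lift (Sum.elim f g) (by rintro x y ⟨rfl, rfl⟩; exact h),
    continuous_quot_lift _ (by fun_prop)⟩

@[simp] theorem wdesc_wl {a : A} {b : B} (f : C(A, Y)) (g : C(B, Y)) (h : f a = g b) (x : A) :
    wdesc f g h (wl a b x) = f x := rfl

@[simp] theorem wdesc_wr {a : A} {b : B} (f : C(A, Y)) (g : C(B, Y)) (h : f a = g b) (x : B) :
    wdesc f g h (wr a b x) = g x := rfl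

theorem wd_cases {a : A} {b : B} {p : Wd A a B b → Prop} (w : Wd A a B b)
    (h1 : ∀ x, p (wl a b x)) (h2 : ∀ x, p (wr a b x)) : p w := by
  induction w using Quot.ind with
  | mk x => cases x with
    | inl x => exact h1 x
    | inr x => exact h2 x

theorem wd_homotopic {a : A} {b : B} {M N : C(Wd A a B b, Y)} (P : C(A, C(I, Y)))
    (Q : C(B, C(I, Y))) (hPQ : P a = Q b)
    (hP0 : ∀ x, P x 0 = M (wl a b x)) (hP1 : ∀ x, P x 1 = N (wl a b x))
    (hQ0 : ∀ x, Q x 0 = M (wr a b x)) (hQ1 : ∀ x, Q x 1 = N (wr a b x)) : M.Homotopic N := by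
  refine homotopic_of_curried (wdesc P Q hPQ) ?_ ?_
  · intro w
    induction w using wd_cases with
    | h1 x => exact hP0 x
    | h2 x => exact hQ0 x
  · intro w
    induction w using wd_cases with
    | h1 x => exact hP1 x
    | h2 x => exact hQ1 x

theorem wd_homotopic_rel {a : A} {b : B} {M N : C(Wd A a B b, Y)}
    (hA : (M.comp (wl a b)).HomotopicRel (N.comp (wl a b)) {a})
    (hB : (M.comp (wr a b)).HomotopicRel (N.comp (wr a b)) {b}) : M.Homotopic N := by
  obtain ⟨F⟩ := hA
  obtain ⟨G⟩ := hB
  refine wd_homotopic (curryH F.toHomotopy) (curryH G.toHomotopy) ?_ ?_ ?_ ?_ ?_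
  · ext t
    have h1 := F.eq_fst t (x := a) rfl
    have h2 := G.eq_fst t (x := b) rfl
    refine h1.trans (Eq.trans ?_ h2.symm)
    simp [wlr]
  · intro x; exact F.map_zero_left x
  · intro x; exact F.map_one_left x
  · intro x; exact G.map_zero_left x
  · intro x; exact G.map_one_left x

theorem fix {b : B} (hb : HEP B b) {M0 M1 M2 : C(B, Y)} (F : M0.Homotopy M1) (G : M1.Homotopy M2)
    (hFG : ∀ t : I, G (t, b) = F (unitInterval.symm t, b)) : M0.HomotopicRel M2 {b} := by
  let ψ : I × I → I := fun q => Set.projIcc (0 : ℝ) 1 zero_le_one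
    ((1 - (q.1 : ℝ)) * (1 - |2 * (q.2 : ℝ) - 1|))
  have hψ : Continuous ψ := by unfold ψ; fun_prop
  let sg : C(I, C(I, Y)) := ContinuousMap.curry ⟨fun q => F (ψ q, b), by fun_prop⟩
  have hsg : ∀ s t, sg s t = F (ψ (s, t), b) := fun s t => rfl
  obtain ⟨H, H0, Hb⟩ := hb C(I, Y) (curryH (F.trans G)) sg (by
    ext t
    rw [hsg, curryH_apply, Homotopy.trans_apply]
    split_ifs with ht
    · congr 2
      apply Subtype.ext
      simp only [ψ, Set.Icc.coe_zero, sub_zero, one_mul]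
      rw [Set.coe_projIcc]
      have := t.2.1
      rw [abs_of_nonpos (by linarith)]
      rw [min_eq_right (by linarith), max_eq_right (by linarith)]; ring
    · rw [hFG]
      congr 2
      apply Subtype.ext
      simp only [ψ, Set.Icc.coe_zero, sub_zero, one_mul]
      rw [Set.coe_projIcc]
      have := t.2.2
      rw [abs_of_nonneg (by linarith)]
      rw [min_eq_right (by linarith), max_eq_right (by linarith)]
      simp)
  have hb0 : ∀ s, H b s 0 = M0 b := by
    intro s
    rw [Hb, hsg]
    have : ψ (s, 0) = 0 := by
      apply Subtype.ext
      simp [ψ]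
    rw [this]; simp
  have hb1 : ∀ s, H b s 1 = M0 b := by
    intro s
    rw [Hb, hsg]
    have : ψ (s, 1) = 0 := by
      apply Subtype.ext
      simp [ψ]; norm_num
    rw [this]; simp
  have hbm : ∀ t, H b 1 t = M0 b := by
    intro s
    rw [Hb, hsg]
    have : ψ (1, s) = 0 := by
      apply Subtype.ext
      simp [ψ]
    rw [this]; simp
  let N0 : C(B, Y) := ⟨fun x => H x 1 0, by fun_prop⟩
  let N1 : C(B, Y) := ⟨fun x => H x 1 1, by fun_prop⟩
  have e1 : M0.HomotopicRel N0 {b} := ⟨{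
    toFun := fun q => H q.2 q.1 0
    continuous_toFun := by fun_prop
    map_zero_left := fun x => by simp [H0, curryH_apply]
    map_one_left := fun x => rfl
    prop' := by
      rintro t x rfl
      exact hb0 t }⟩
  have e2 : N0.HomotopicRel N1 {b} := ⟨{
    toFun := fun q => H q.2 1 q.1
    continuous_toFun := by fun_prop
    map_zero_left := fun x => rfl
    map_one_left := fun x => rfl
    prop' := by
      rintro t x rfl
      exact (hbm t).trans (hbm 0).symm }⟩
  have e3 : M2.HomotopicRel N1 {b} := ⟨{
    toFun := fun q => H q.2 q.1 1
    continuous_toFun := by fun_prop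
    map_zero_left := fun x => by simp [H0, curryH_apply]
    map_one_left := fun x => rfl
    prop' := by
      rintro t x rfl
      refine (hb1 t).trans ?_
      have := hFG 1
      simp at this
      exact this.symm }⟩
  exact (e1.trans e2).trans e3.symm

theorem drag {b : B} (hb : HEP B b) {a1 a2 : A} (γ : Path a1 a2) :
    ∃ k : C(Wd A a1 B b, Wd A a2 B b), (∀ x, k (wl a1 b x) = wl a2 b x) ∧
      ∃ H : (k.comp (wr a1 b)).Homotopy (wr a2 b), ∀ t, H (t, b) = wl a2 b (γ t) := by
  obtain ⟨D, D0, Db⟩ := hb (Wd A a2 B b) (wr a2 b)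
    ⟨fun t => wl a2 b (γ.symm t), by fun_prop⟩ (by simp [wlr])
  let k : C(Wd A a1 B b, Wd A a2 B b) := wdesc (wl a2 b) ⟨fun x => D x 1, by fun_prop⟩ (by
    simp [Db])
  refine ⟨k, fun x => rfl, ?_⟩
  refine ⟨{
    toFun := fun q => D q.2 (unitInterval.symm q.1)
    continuous_toFun := by fun_prop
    map_zero_left := fun x => by simp [k]
    map_one_left := fun x => by simp [D0] }, ?_⟩
  intro t
  show D b (unitInterval.symm t) = _
  simp [Db]

theorem drag_comp {b : B} (hb : HEP B b) {a1 a2 : A} (γ : Path a1 a2)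
    (k : C(Wd A a1 B b, Wd A a2 B b)) (hk : ∀ x, k (wl a1 b x) = wl a2 b x)
    (H : (k.comp (wr a1 b)).Homotopy (wr a2 b)) (hH : ∀ t, H (t, b) = wl a2 b (γ t))
    (k' : C(Wd A a2 B b, Wd A a1 B b)) (hk' : ∀ x, k' (wl a2 b x) = wl a1 b x)
    (H' : (k'.comp (wr a2 b)).Homotopy (wr a1 b)) (hH' : ∀ t, H' (t, b) = wl a1 b (γ.symm t)) :
    (k'.comp k).Homotopic (ContinuousMap.id _) := by
  apply wd_homotopic_rel
  · have : ((k'.comp k).comp (wl a1 b)) = (ContinuousMap.id _).comp (wl a1 b) := by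
      ext x; simp [hk, hk']
    rw [this]
    exact HomotopicRel.refl _
  · let F : ((k'.comp k).comp (wr a1 b)).Homotopy (k'.comp (wr a2 b)) := {
      toFun := fun q => k' (H q)
      continuous_toFun := by fun_prop
      map_zero_left := fun x => by simp
      map_one_left := fun x => by simp }
    refine fix hb F H' ?_
    intro t
    refine (hH' t).trans ?_
    refine Eq.trans ?_ (congrArg k' (hH (unitInterval.symm t))).symm
    rw [hk']; rfl

theorem drag_isHE {b : B} (hb : HEP B b) {a1 a2 : A} (γ : Path a1 a2) :
    ∃ k : C(Wd A a1 B b, Wd A a2 B b), IsHE k ∧ (∀ x, k (wl a1 b x) = wl a2 b x) ∧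
      ∃ H : (k.comp (wr a1 b)).Homotopy (wr a2 b), ∀ t, H (t, b) = wl a2 b (γ t) := by
  obtain ⟨k, hk, H, hH⟩ := drag hb γ
  obtain ⟨k', hk', H', hH'⟩ := drag hb γ.symm
  refine ⟨k, ⟨k', drag_comp hb γ k hk H hH k' hk' H' hH', ?_⟩, hk, H, hH⟩
  exact drag_comp hb γ.symm k' hk' H' hH' k hk H (by simpa using hH)

def wmap (f : C(A, A')) (a : A) (b : B) : C(Wd A a B b, Wd A' (f a) B b) :=
  wdesc ((wl (f a) b).comp f) (wr (f a) b) (wlr _ _)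

theorem wmap_left {b : B} (hb : HEP B b) (f : C(A, A')) (f' : C(A', A))
    (P : (f'.comp f).Homotopy (ContinuousMap.id A)) (a : A) :
    ∃ k : C(Wd A (f' (f a)) B b, Wd A a B b), IsHE k ∧
      ((k.comp (wmap f' (f a) b)).comp (wmap f a b)).Homotopic (ContinuousMap.id _) := by
  let γ : Path (f' (f a)) a := {
    toFun := fun t => P (t, a)
    continuous_toFun := by fun_prop
    source' := by simp
    target' := by simp }
  obtain ⟨k, hk, hk1, H, hH⟩ := drag_isHE hb γ
  refine ⟨k, hk, ?_⟩
  refine wd_homotopic (curryH ((ContinuousMap.Homotopy.refl (wl a b)).comp P)) (curryH H) ?_ ?_ ?_ ?_ ?_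
  · ext t
    simp only [curryH_apply, hH]
    rfl
  · intro x
    simp [curryH_apply, wmap, hk1]
  · intro x
    simp [curryH_apply]
  · intro x
    simp [curryH_apply, wmap]
  · intro x
    simp [curryH_apply]

theorem wmap_isHE {b : B} (hb : HEP B b) (f : C(A, A')) (hf : IsHE f) (a : A) :
    IsHE (wmap f a b) := by
  obtain ⟨f', ⟨P⟩, ⟨Q⟩⟩ := hf
  obtain ⟨k, hk, h1⟩ := wmap_left hb f f' P a
  obtain ⟨k2, hk2, h2⟩ := wmap_left hb f' f Q (f a)
  exact isHE_of_six _ (wmap f' (f a) b) k (k2.comp (wmap f (f' (f a)) b)) hk h1 h2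

theorem wd_congr {b : B} (hb : HEP B b) (e : A ≃ₕ A') (a : A) (a' : A')
    (h : Joined (e.toFun a) a') : Nonempty (Wd A a B b ≃ₕ Wd A' a' B b) := by
  obtain ⟨e1⟩ := (wmap_isHE hb e.toFun ⟨e.invFun, e.left_inv, e.right_inv⟩ a).nonempty
  obtain ⟨γ⟩ := h
  obtain ⟨k, hk, -⟩ := drag_isHE hb γ
  obtain ⟨e2⟩ := hk.nonempty
  exact ⟨e1.trans e2⟩

theorem wd_swap (a : A) (b : B) : Nonempty (Wd A a B b ≃ₕ Wd B b A a) := by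
  refine ⟨⟨wdesc (wr b a) (wl b a) (wlr _ _).symm, wdesc (wr a b) (wl a b) (wlr _ _).symm, ?_, ?_⟩⟩
  all_goals
    convert Homotopic.refl _ using 1
    ext w
    induction w using wd_cases with
    | h1 x => rfl
    | h2 x => rfl

theorem wd_congr_right {a : A} (ha : HEP A a) (b b' : B) (h : Joined b b') :
    Nonempty (Wd A a B b ≃ₕ Wd A a B b') := by
  obtain ⟨e1⟩ := wd_swap a b
  obtain ⟨e2⟩ := wd_congr ha (ContinuousMap.HomotopyEquiv.refl B) b b' h
  obtain ⟨e3⟩ := wd_swap b' a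
  exact ⟨(e1.trans e2).trans e3⟩

theorem wd_subsingleton [Subsingleton A] (a : A) (b : B) :
    Nonempty (Wd A a B b ≃ₕ B) := by
  refine ⟨⟨wdesc (ContinuousMap.const A b) (ContinuousMap.id B) rfl, wr a b, ?_, ?_⟩⟩
  · convert Homotopic.refl _ using 1
    ext w
    induction w using wd_cases with
    | h1 x => 
      rw [Subsingleton.elim x a]
      exact wlr a b
    | h2 x => rfl
  · convert Homotopic.refl _ using 1
    rfl

end wd
end SubstHE


namespace SubstHE
open ContinuousMap
open scoped unitInterval

def DownC {V : Type} (K : Set (Finset V)) : Prop := ∀ sg ∈ K, ∀ τ ⊆ sg, τ ∈ K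

section geom
variable {V : Type} [Fintype V] {K : Set (Finset V)}

theorem gr_nonneg {f : V → ℝ} (h : f ∈ geomReal K) (v : V) : 0 ≤ f v := (h.1 v).1

theorem gr_sum {f : V → ℝ} (h : f ∈ geomReal K) : ∑ v, f v = 1 := h.2.1

theorem gr_supp {f : V → ℝ} (h : f ∈ geomReal K) : ∃ sg ∈ K, ∀ v, v ∈ sg ↔ f v ≠ 0 :=
  ⟨_, h.2.2, by simp⟩

theorem gr_mem (hK : DownC K) {f : V → ℝ} (h0 : ∀ v, 0 ≤ f v) (h1 : ∑ v, f v = 1)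
    {sg : Finset V} (hsg : sg ∈ K) (hs : ∀ v, f v ≠ 0 → v ∈ sg) : f ∈ geomReal K := by
  refine ⟨fun v => ⟨h0 v, ?_⟩, h1, hK sg hsg _ ?_⟩
  · rw [← h1]
    exact Finset.single_le_sum (fun w _ => h0 w) (Finset.mem_univ v)
  · intro v hv
    exact hs v (by simpa using hv)

theorem gr_mono {L : Set (Finset V)} (h : K ⊆ L) : geomReal K ⊆ geomReal L :=
  fun _ hf => ⟨hf.1, hf.2.1, h hf.2.2⟩

theorem gr_seg (hK : DownC K) {f g : V → ℝ} (hf : f ∈ geomReal K) (hg : g ∈ geomReal K)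
    {sg : Finset V} (hsg : sg ∈ K) (hfs : ∀ v, f v ≠ 0 → v ∈ sg) (hgs : ∀ v, g v ≠ 0 → v ∈ sg)
    {t : ℝ} (ht0 : 0 ≤ t) (ht1 : t ≤ 1) : (1 - t) • f + t • g ∈ geomReal K := by
  refine gr_mem hK ?_ ?_ hsg ?_
  · intro v
    have := gr_nonneg hf v
    have := gr_nonneg hg v
    simp only [Pi.add_apply, Pi.smul_apply, smul_eq_mul]
    have : 0 ≤ 1 - t := by linarith
    positivity
  · simp only [Pi.add_apply, Pi.smul_apply, smul_eq_mul, Finset.sum_add_distrib, ← Finset.mul_sum,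
      gr_sum hf, gr_sum hg]
    ring
  · intro v hv
    by_contra hc
    have h1 : f v = 0 := by by_contra h; exact hc (hfs v h)
    have h2 : g v = 0 := by by_contra h; exact hc (hgs v h)
    simp [h1, h2] at hv

theorem contig {T : Type} [TopologicalSpace T] (hK : DownC K) (E0 E1 : C(T, geomReal K))
    (S : Set T) (hS : ∀ x ∈ S, E0 x = E1 x)
    (h : ∀ x, ∃ sg ∈ K, (∀ v, (E0 x).1 v ≠ 0 → v ∈ sg) ∧ (∀ v, (E1 x).1 v ≠ 0 → v ∈ sg)) :
    E0.HomotopicRel E1 S := by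
  have hm : ∀ q : I × T, (1 - (q.1 : ℝ)) • (E0 q.2).1 + (q.1 : ℝ) • (E1 q.2).1 ∈ geomReal K := by
    intro q
    obtain ⟨sg, hsg, h0, h1⟩ := h q.2
    exact gr_seg hK (E0 q.2).2 (E1 q.2).2 hsg h0 h1 q.1.2.1 q.1.2.2
  refine ⟨{
    toFun := fun q => ⟨(1 - (q.1 : ℝ)) • (E0 q.2).1 + (q.1 : ℝ) • (E1 q.2).1, hm q⟩
    continuous_toFun := Continuous.subtype_mk (by fun_prop) _
    map_zero_left := fun x => by simp
    map_one_left := fun x => by simp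
    prop' := ?_ }⟩
  · intro t x hx
    apply Subtype.ext
    simp only [ContinuousMap.coe_mk]
    rw [← hS x hx, ← add_smul]
    simp

theorem gr_joined (hK : DownC K) (f g : geomReal K)
    {sg : Finset V} (hsg : sg ∈ K) (hfs : ∀ v, f.1 v ≠ 0 → v ∈ sg) (hgs : ∀ v, g.1 v ≠ 0 → v ∈ sg) :
    Joined f g := by
  obtain ⟨H⟩ := contig (T := Unit) hK ⟨fun _ => f, by fun_prop⟩ ⟨fun _ => g, by fun_prop⟩ ∅
    (by simp) (fun x => ⟨sg, hsg, hfs, hgs⟩)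
  exact ⟨{
    toFun := fun t => H (t, ())
    continuous_toFun := by fun_prop
    source' := by simp
    target' := by simp }⟩

theorem cont_shrink {E : Type} [NormedAddCommGroup E] [NormedSpace ℝ E] (S : Set E) (p : E)
    (d : E → ℝ) (hd : Continuous d) (hd0 : ∀ x, 0 ≤ d x) (hd1 : ∀ x, d x = 0 → x = p) :
    Continuous fun q : S × I =>
      p + (min (d q.1) (max 0 (2 * d q.1 - (q.2 : ℝ))) / d q.1) • ((q.1 : E) - p) := by
  refine continuous_const.add ?_
  rw [continuous_iff_continuousAt]
  rintro q0
  by_cases h : d q0.1 = 0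
  · have hz : (q0.1 : E) - p = 0 := by rw [hd1 _ h, sub_self]
    unfold ContinuousAt
    simp only [hz, smul_zero]
    refine squeeze_zero_norm (a := fun q : S × I => ‖(q.1 : E) - p‖) ?_ ?_
    · intro q
      rw [norm_smul]
      refine mul_le_of_le_one_left (norm_nonneg _) ?_
      have h0 := hd0 q.1
      rw [Real.norm_of_nonneg (by positivity)]
      exact div_le_one_of_le₀ (min_le_left _ _) h0
    · have : Continuous fun q : S × I => ‖(q.1 : E) - p‖ := by fun_prop
      have := this.tendsto q0
      simpa [hz] using this
  · refine ContinuousAt.smul (ContinuousAt.div ?_ ?_ h) ?_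
    · exact Continuous.continuousAt (by fun_prop)
    · exact Continuous.continuousAt (by fun_prop)
    · exact Continuous.continuousAt (by fun_prop)

theorem hep_star {E : Type} [NormedAddCommGroup E] [NormedSpace ℝ E] (S : Set E) (p : S)
    (ε : ℝ) (hε : 0 < ε)
    (hS : ∀ x ∈ S, ‖x - p‖ < ε → ∀ t : ℝ, 0 ≤ t → t ≤ 1 → (p : E) + t • (x - p) ∈ S) :
    HEP S p := by
  intro Y _ g γ h0
  let d : E → ℝ := fun x => ‖x - p‖ / ε
  have hd : Continuous d := by unfold d; fun_prop
  have hd0 : ∀ x, 0 ≤ d x := fun x => by unfold d; positivity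
  have hd1 : ∀ x, d x = 0 → x = p := by
    intro x hx
    simp only [d, div_eq_zero_iff, hε.ne', or_false, norm_eq_zero] at hx
    exact sub_eq_zero.mp hx
  have hc := cont_shrink S (p : E) d hd hd0 hd1
  have hm : ∀ q : S × I,
      (p : E) + (min (d q.1) (max 0 (2 * d q.1 - (q.2 : ℝ))) / d q.1) • ((q.1 : E) - p) ∈ S := by
    intro q
    by_cases h : ‖(q.1 : E) - p‖ < ε
    · refine hS _ q.1.2 h _ ?_ ?_
      · have := hd0 q.1
        positivity
      · exact div_le_one_of_le₀ (min_le_left _ _) (hd0 _)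
    · have h1 : 1 ≤ d q.1 := by
        unfold d
        rw [le_div_iff₀ hε]; linarith
      have h2 := q.2.2.2
      rw [max_eq_right (by linarith), min_eq_left (by linarith), div_self (by linarith)]
      simp
  let y : C(S × I, S) := ⟨fun q => ⟨_, hm q⟩, hc.subtype_mk _⟩
  have hdp : d p = 0 := by simp [d]
  let F : C(S × I, Y) := ⟨fun q => if (q.2 : ℝ) ≤ 2 * d q.1 then g (y q)
      else γ (Set.projIcc 0 1 zero_le_one ((q.2 : ℝ) - 2 * d q.1)), by
    refine Continuous.if_le (by fun_prop) (by fun_prop) (by fun_prop) (by fun_prop) ?_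
    intro q hq
    rw [hq, sub_self, Set.projIcc_left]
    have : y q = p := by
      apply Subtype.ext
      simp [y, hq, hd0]
    rw [this]
    exact h0.symm⟩
  refine ⟨F.curry, ?_, ?_⟩
  · intro x
    have h1 := hd0 x
    have : y (x, 0) = x := by
      apply Subtype.ext
      simp only [y, ContinuousMap.coe_mk, Set.Icc.coe_zero, sub_zero]
      rw [max_eq_right (by linarith), min_eq_left (by linarith)]
      by_cases h : d x = 0
      · rw [hd1 _ h]; simp
      · rw [div_self h]; simp
    simp [F, h1, this]
  · ext t
    simp only [F, ContinuousMap.curry_apply, ContinuousMap.coe_mk, hdp, mul_zero, sub_zero]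
    split_ifs with h
    · have : t = 0 := by
        apply Subtype.ext
        exact le_antisymm h t.2.1
      subst this
      have : y (p, 0) = p := by
        apply Subtype.ext
        simp [y]
      rw [this, h0]
    · simp

theorem hep_gr (hK : DownC K) (p : geomReal K) : HEP (geomReal K) p := by
  have : ∃ ε : ℝ, 0 < ε ∧ ∀ v, p.1 v ≠ 0 → ε ≤ p.1 v := by
    obtain ⟨sg, hsg, hs⟩ := gr_supp p.2
    have hne : sg.Nonempty := by
      by_contra hc
      rw [Finset.not_nonempty_iff_eq_empty] at hc
      have h1 := gr_sum p.2
      have : ∀ v, p.1 v = 0 := by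
        intro v; by_contra h
        have := (hs v).2 h
        simp [hc] at this
      simp [this] at h1
    obtain ⟨w, hw, hmin⟩ := sg.exists_min_image p.1 hne
    refine ⟨p.1 w, lt_of_le_of_ne (gr_nonneg p.2 w) (Ne.symm ((hs w).1 hw)), ?_⟩
    intro v hv
    exact hmin v ((hs v).2 hv)
  obtain ⟨ε, hε, hm⟩ := this
  refine hep_star _ p ε hε ?_
  intro x hx hlt t ht0 ht1
  obtain ⟨sg, hsg, hs⟩ := gr_supp hx
  have := gr_seg hK p.2 hx hsg (fun v hv => ?_) (fun v hv => (hs v).2 hv) ht0 ht1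
  · convert this using 1
    ext v
    simp; ring
  · rw [hs]
    intro h0
    have h1 : ‖(x - p.1) v‖ ≤ ‖x - p.1‖ := norm_le_pi_norm _ v
    have h2 := hm v hv
    rw [Pi.sub_apply, h0, zero_sub, norm_neg, Real.norm_eq_abs] at h1
    have := le_abs_self (p.1 v)
    linarith

end geom
end SubstHE


namespace SubstHE
open ContinuousMap
open scoped unitInterval

section step
set_option linter.unusedSectionVars false
variable {V : Type} [Fintype V] [DecidableEq V] (b : Finset V) (v : V)

def bs (f : V → ℝ) : ℝ := ∑ w ∈ b, f w

def comb (α β c : ℝ) (f : V → ℝ) : V → ℝ := fun w =>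
  (if w ∈ b then β else α) * f w + (if w = v then c else 0)

def pA (f : V → ℝ) : V → ℝ :=
  comb b v (max 0 (1 - 3 * bs b f)) 0 (1 - max 0 (1 - 3 * bs b f) * (1 - bs b f)) f

noncomputable def aB (s : ℝ) : ℝ := max 0 (min (9 * s - 3) (1 + 3 * s))
noncomputable def bB (s : ℝ) : ℝ := max 0 (3 * s - 2)
noncomputable def aE (s : ℝ) : ℝ := 1 / (1 - min s (2 / 3)) + max 0 (3 * s - 2)

noncomputable def pB (f : V → ℝ) : V → ℝ :=
  comb b v (aB (bs b f)) (bB (bs b f)) (1 - aB (bs b f) * (1 - bs b f) - bB (bs b f) * bs b f) f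

noncomputable def pE (f : V → ℝ) : V → ℝ :=
  comb b v (aE (bs b f)) (bB (bs b f)) 0 f

theorem bs_cont : Continuous (bs b : (V → ℝ) → ℝ) := by unfold bs; fun_prop

theorem comb_cont {α β c : (V → ℝ) → ℝ} (hα : Continuous α) (hβ : Continuous β)
    (hc : Continuous c) : Continuous fun f => comb b v (α f) (β f) (c f) f := by
  unfold comb
  refine continuous_pi fun w => ?_
  split_ifs <;> fun_prop

theorem pA_cont : Continuous (pA b v) := by
  have := bs_cont b
  apply comb_cont <;> fun_prop

theorem aB_cont : Continuous aB := by unfold aB; fun_prop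
theorem bB_cont : Continuous bB := by unfold bB; fun_prop
theorem aE_cont : Continuous aE := by
  unfold aE
  refine Continuous.add (Continuous.div (by fun_prop) (by fun_prop) ?_) (by fun_prop)
  intro s
  have := min_le_right s (2 / 3)
  linarith

theorem pB_cont : Continuous (pB b v) := by
  have := bs_cont b
  have := aB_cont
  have := bB_cont
  apply comb_cont <;> fun_prop

theorem pE_cont : Continuous (pE b v) := by
  have := bs_cont b
  have := aE_cont
  have := bB_cont
  apply comb_cont <;> fun_prop

variable {b v} {K : Set (Finset V)}

theorem bs_nonneg {f : V → ℝ} (hf : f ∈ geomReal K) : 0 ≤ bs b f :=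
  Finset.sum_nonneg fun w _ => gr_nonneg hf w

theorem bs_compl {f : V → ℝ} (hf : f ∈ geomReal K) : ∑ w ∈ bᶜ, f w = 1 - bs b f := by
  have := Finset.sum_add_sum_compl b f
  rw [gr_sum hf] at this
  unfold bs; linarith

theorem bs_le_one {f : V → ℝ} (hf : f ∈ geomReal K) : bs b f ≤ 1 := by
  have := bs_compl (b := b) hf
  have h2 : 0 ≤ ∑ w ∈ bᶜ, f w := Finset.sum_nonneg fun w _ => gr_nonneg hf w
  linarith

theorem comb_sum {L : Set (Finset V)} {f : V → ℝ} (hf : f ∈ geomReal L) (α β c : ℝ) :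
    ∑ w, comb b v α β c f w = α * (1 - bs b f) + β * bs b f + c := by
  unfold comb
  rw [Finset.sum_add_distrib, Finset.sum_ite_eq' Finset.univ v, ← Finset.sum_add_sum_compl b]
  have h1 : ∑ w ∈ b, (if w ∈ b then β else α) * f w = β * bs b f := by
    unfold bs
    rw [Finset.mul_sum]
    exact Finset.sum_congr rfl fun w hw => by rw [if_pos hw]
  have h2 : ∑ w ∈ bᶜ, (if w ∈ b then β else α) * f w = α * (1 - bs b f) := by
    rw [← bs_compl hf, Finset.mul_sum]
    exact Finset.sum_congr rfl fun w hw => by rw [if_neg (Finset.mem_compl.1 hw)]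
  rw [h1, h2]; simp; ring

theorem comb_supp {α β c : ℝ} {f : V → ℝ} {sg : Finset V} 
    (h1 : α ≠ 0 → ∀ w, w ∉ b → f w ≠ 0 → w ∈ sg) (h2 : β ≠ 0 → ∀ w ∈ b, f w ≠ 0 → w ∈ sg)
    (h3 : c ≠ 0 → v ∈ sg) (w : V) (hw : comb b v α β c f w ≠ 0) : w ∈ sg := by
  by_contra hc
  apply hw
  unfold comb
  have e2 : (if w = v then c else 0) = 0 := by
    split_ifs with h
    · by_contra h'
      exact hc (h ▸ h3 h')
    · rfl
  rw [e2, add_zero]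
  by_cases hf : f w = 0
  · simp [hf]
  split_ifs with h
  · have : β = 0 := by by_contra h'; exact hc (h2 h' w h hf)
    simp [this]
  · have : α = 0 := by by_contra h'; exact hc (h1 h' w h hf)
    simp [this]

theorem comb_mem (hK : DownC K) {L : Set (Finset V)} {α β c : ℝ} {f : V → ℝ} (hf : f ∈ geomReal L)
    (ha : 0 ≤ α) (hb : 0 ≤ β) (hc : 0 ≤ c) (hsum : α * (1 - bs b f) + β * bs b f + c = 1)
    {sg : Finset V} (hsg : sg ∈ K) 
    (hs : ∀ w, comb b v α β c f w ≠ 0 → w ∈ sg) :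
    comb b v α β c f ∈ geomReal K := by
  refine gr_mem hK ?_ (by rw [comb_sum hf, hsum]) hsg hs
  intro w
  have := gr_nonneg hf w
  unfold comb
  split_ifs <;> positivity

def dirac (v : V) : V → ℝ := fun w => if w = v then 1 else 0

theorem comb_dirac (f : V → ℝ) : comb b v 0 0 1 f = dirac v := by
  ext w; simp [comb, dirac]

theorem dirac_mem (hK : DownC K) (h : {v} ∈ K) : dirac v ∈ geomReal K := by
  refine gr_mem hK ?_ ?_ h ?_
  · intro w; unfold dirac; split_ifs <;> norm_num
  · simp [dirac]
  · intro w hw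
    by_contra hc
    simp at hc
    simp [dirac, hc] at hw

theorem bs_dirac (hv : v ∈ b) : bs b (dirac v) = 1 := by
  simp [bs, dirac, hv]

theorem comb_dirac_self (hv : v ∈ b) (α β c : ℝ) (h : β + c = 1) :
    comb b v α β c (dirac v) = dirac v := by
  ext w
  by_cases hw : w = v
  · subst hw; simp [comb, dirac, hv, h]
  · simp [comb, dirac, hw]

theorem pA_dirac (hv : v ∈ b) : pA b v (dirac v) = dirac v := by
  unfold pA
  apply comb_dirac_self hv
  rw [bs_dirac hv]; norm_num

theorem pB_dirac (hv : v ∈ b) : pB b v (dirac v) = dirac v := by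
  unfold pB
  apply comb_dirac_self hv
  rw [bs_dirac hv]; norm_num

theorem pE_dirac (hv : v ∈ b) : pE b v (dirac v) = dirac v := by
  unfold pE
  apply comb_dirac_self hv
  rw [bs_dirac hv]; norm_num [bB]

theorem pA_big {f : V → ℝ} (hs : 1 / 3 ≤ bs b f) : pA b v f = dirac v := by
  unfold pA
  rw [max_eq_left (by linarith)]
  simp [comb_dirac]

theorem pB_small {f : V → ℝ} (hs : bs b f ≤ 1 / 3) : pB b v f = dirac v := by
  unfold pB aB bB
  rw [max_eq_left ((min_le_left _ _).trans (by linarith)), max_eq_left (by linarith)]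
  simp [comb_dirac]

variable {L : Set (Finset V)} {f : V → ℝ} {τ : Finset V}

theorem pA_supp1 (hτ : ∀ w, f w ≠ 0 → w ∈ τ) (w : V) (hw : pA b v f w ≠ 0) :
    w ∈ insert v (τ \ b) := by
  refine comb_supp ?_ (fun h => absurd rfl h) (fun _ => by simp) w hw
  intro _ w hw hf
  simp [hw, hτ w hf]

theorem pA_supp2 (hτ : ∀ w, f w ≠ 0 → w ∈ τ) (hs : bs b f = 0 ∨ v ∈ τ)
    (w : V) (hw : pA b v f w ≠ 0) : w ∈ τ := by
  refine comb_supp (fun _ w _ hf => hτ w hf) (fun h => absurd rfl h) ?_ w hw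
  rcases hs with hs | hs
  · intro h; simp [hs] at h
  · exact fun _ => hs

theorem pA_mem (hK : DownC K) (hf : f ∈ geomReal L) (hτ : τ ∈ K)
    (hs : ∀ w, pA b v f w ≠ 0 → w ∈ τ) : pA b v f ∈ geomReal K := by
  have h0 := bs_nonneg (b := b) hf
  have h1 := bs_le_one (b := b) hf
  refine comb_mem hK hf (le_max_left _ _) le_rfl ?_ (by ring) hτ hs
  rcases max_cases 0 (1 - 3 * bs b f) with h | h <;> rw [h.1] <;> nlinarith

theorem pB_supp1 (hτ : ∀ w, f w ≠ 0 → w ∈ τ) (hs : bs b f ≤ 2 / 3) (w : V)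
    (hw : pB b v f w ≠ 0) : w ∈ insert v (τ \ b) := by
  refine comb_supp ?_ ?_ (fun _ => by simp) w hw
  · intro _ w hw hf
    simp [hw, hτ w hf]
  · intro h
    exact absurd (max_eq_left (by linarith)) h

theorem pBc {s : ℝ} (hs : 2 / 3 ≤ s) : 1 - aB s * (1 - s) - bB s * s = 0 := by
  unfold aB bB
  rw [min_eq_right (by linarith), max_eq_right (by linarith), max_eq_right (by linarith)]
  ring

theorem pB_supp2 (hτ : ∀ w, f w ≠ 0 → w ∈ τ) (hs : 2 / 3 ≤ bs b f) (w : V)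
    (hw : pB b v f w ≠ 0) : w ∈ τ := by
  refine comb_supp (fun _ w _ hf => hτ w hf) (fun _ w _ hf => hτ w hf) ?_ w hw
  intro h
  exact absurd (pBc hs) h

theorem pB_mem (hK : DownC K) (hf : f ∈ geomReal L) (hτ : τ ∈ K)
    (hs : ∀ w, pB b v f w ≠ 0 → w ∈ τ) : pB b v f ∈ geomReal K := by
  have h0 := bs_nonneg (b := b) hf
  have h1 := bs_le_one (b := b) hf
  refine comb_mem hK hf (le_max_left _ _) (le_max_left _ _) ?_ (by ring) hτ hs
  rcases le_total (2 / 3) (bs b f) with h | h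
  · rw [pBc h]
  · unfold aB bB
    rw [min_eq_left (by linarith), max_eq_left (a := 0) (b := 3 * bs b f - 2) (by linarith)]
    rcases max_cases 0 (9 * bs b f - 3) with h' | h' <;> rw [h'.1]
    · norm_num
    · nlinarith [sq_nonneg (3 * bs b f - 2)]

theorem pE_supp (hτ : ∀ w, f w ≠ 0 → w ∈ τ) (w : V)
    (hw : pE b v f w ≠ 0) : w ∈ τ :=
  comb_supp (fun _ w _ hf => hτ w hf) (fun _ w _ hf => hτ w hf) (fun h => absurd rfl h) w hw

theorem pE_supp1 (hτ : ∀ w, f w ≠ 0 → w ∈ τ) (hs : bs b f ≤ 2 / 3) (w : V)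
    (hw : pE b v f w ≠ 0) : w ∈ insert v (τ \ b) := by
  refine comb_supp ?_ ?_ (fun _ => by simp) w hw
  · intro _ w hw hf
    simp [hw, hτ w hf]
  · intro h
    exact absurd (max_eq_left (by linarith)) h

theorem pE_mem (hK : DownC K) (hf : f ∈ geomReal L) (hτ : τ ∈ K)
    (hs : ∀ w, pE b v f w ≠ 0 → w ∈ τ) : pE b v f ∈ geomReal K := by
  have h0 := bs_nonneg (b := b) hf
  have h1 := bs_le_one (b := b) hf
  have hm := min_le_right (bs b f) (2 / 3)
  refine comb_mem hK hf ?_ (le_max_left _ _) le_rfl ?_ hτ hs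
  · unfold aE
    have : 0 ≤ 1 - min (bs b f) (2 / 3) := by linarith
    positivity
  · unfold aE bB
    rcases le_total (2 / 3) (bs b f) with h | h
    · rw [min_eq_right h, max_eq_right (by linarith)]; ring
    · rw [min_eq_left h, max_eq_left (by linarith)]
      have : 1 - bs b f ≠ 0 := by linarith
      field_simp; ring

end step
end SubstHE


namespace SubstHE
open ContinuousMap
open scoped unitInterval

theorem step {V : Type} [Fintype V] [DecidableEq V] (b : Finset V) (v : V) (hv : v ∈ b)
    (S Z X : Set (Finset V)) (dS : DownC S) (dZ : DownC Z) (dX : DownC X)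
    (hSX : S ⊆ X) (hZX : Z ⊆ X)
    (h2 : ∀ τ ∈ S, ∀ w ∈ τ, w ∈ b → w = v)
    (h3 : ∀ τ ∈ X, (∀ w ∈ τ, w ∉ b) → τ ∈ S)
    (h4 : ∀ τ ∈ X, (∃ w ∈ τ, w ∈ b) → τ ∈ Z)
    (h5 : ∀ τ ∈ Z, insert v (τ \ b) ∈ S) (h6 : ∀ τ ∈ Z, insert v (τ \ b) ∈ Z)
    (hvS : {v} ∈ S) (hvZ : {v} ∈ Z) :
    Nonempty (geomReal X ≃ₕ Wd (geomReal S) ⟨dirac v, dirac_mem dS hvS⟩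
      (geomReal Z) ⟨dirac v, dirac_mem dZ hvZ⟩) := by
  have hpos : ∀ f : V → ℝ, ∀ τ : Finset V, (∀ w, w ∈ τ ↔ f w ≠ 0) → bs b f ≠ 0 →
      ∃ w ∈ τ, w ∈ b := by
    intro f τ hτ h
    obtain ⟨w, hw, hf⟩ := Finset.exists_ne_zero_of_sum_ne_zero h
    exact ⟨w, (hτ w).2 hf, hw⟩
  have hzero : ∀ f ∈ geomReal X, ∀ τ : Finset V, (∀ w, w ∈ τ ↔ f w ≠ 0) → bs b f = 0 →
      ∀ w ∈ τ, w ∉ b := by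
    intro f hf τ hτ h w hw hb
    have := (Finset.sum_eq_zero_iff_of_nonneg (fun w _ => gr_nonneg hf w)).1 h w hb
    exact (hτ w).1 hw this
  have mA : ∀ f ∈ geomReal X, pA b v f ∈ geomReal S := by
    intro f hf
    obtain ⟨τ, hτ, hs⟩ := gr_supp hf
    by_cases h0 : bs b f = 0
    · exact pA_mem dS hf (h3 τ hτ (hzero f hf τ hs h0)) (pA_supp2 (fun w => (hs w).2) (Or.inl h0))
    · exact pA_mem dS hf (h5 τ (h4 τ hτ (hpos f τ hs h0))) (pA_supp1 (fun w => (hs w).2))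
  have mB : ∀ f ∈ geomReal X, pB b v f ∈ geomReal Z := by
    intro f hf
    obtain ⟨τ, hτ, hs⟩ := gr_supp hf
    by_cases h0 : bs b f = 0
    · rw [pB_small (by rw [h0]; norm_num)]
      exact dirac_mem dZ hvZ
    · have hZ := h4 τ hτ (hpos f τ hs h0)
      rcases le_total (bs b f) (2 / 3) with h | h
      · exact pB_mem dZ hf (h6 τ hZ) (pB_supp1 (fun w => (hs w).2) h)
      · exact pB_mem dZ hf hZ (pB_supp2 (fun w => (hs w).2) h)
  have mE : ∀ (K : Set (Finset V)), DownC K → ∀ f ∈ geomReal K, pE b v f ∈ geomReal K := by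
    intro K dK f hf
    obtain ⟨τ, hτ, hs⟩ := gr_supp hf
    exact pE_mem dK hf hτ (pE_supp (fun w => (hs w).2))
  set vA : geomReal S := ⟨dirac v, dirac_mem dS hvS⟩ with hvA
  set vB : geomReal Z := ⟨dirac v, dirac_mem dZ hvZ⟩ with hvB
  have cA := pA_cont b v
  have cB := pB_cont b v
  have cE := pE_cont b v
  have cs := bs_cont b
  let rA : C(geomReal X, geomReal S) := ⟨fun f => ⟨pA b v f.1, mA f.1 f.2⟩,
    Continuous.subtype_mk (by fun_prop) _⟩
  let rB : C(geomReal X, geomReal Z) := ⟨fun f => ⟨pB b v f.1, mB f.1 f.2⟩,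
    Continuous.subtype_mk (by fun_prop) _⟩
  let eX : C(geomReal X, geomReal X) := ⟨fun f => ⟨pE b v f.1, mE X dX f.1 f.2⟩,
    Continuous.subtype_mk (by fun_prop) _⟩
  let eZ : C(geomReal Z, geomReal Z) := ⟨fun f => ⟨pE b v f.1, mE Z dZ f.1 f.2⟩,
    Continuous.subtype_mk (by fun_prop) _⟩
  let iA : C(geomReal S, geomReal X) := ⟨fun f => ⟨f.1, gr_mono hSX f.2⟩,
    Continuous.subtype_mk (by fun_prop) _⟩
  let iB : C(geomReal Z, geomReal X) := ⟨fun f => ⟨f.1, gr_mono hZX f.2⟩,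
    Continuous.subtype_mk (by fun_prop) _⟩
  have rA_big : ∀ f : geomReal X, 1 / 3 ≤ bs b f.1 → rA f = vA := fun f h =>
    Subtype.ext (pA_big h)
  have rB_small : ∀ f : geomReal X, bs b f.1 ≤ 1 / 3 → rB f = vB := fun f h =>
    Subtype.ext (pB_small h)
  let r : C(geomReal X, Wd (geomReal S) vA (geomReal Z) vB) :=
    ⟨fun f => if bs b f.1 ≤ 1 / 3 then wl vA vB (rA f) else wr vA vB (rB f), by
      refine Continuous.if_le (by fun_prop) (by fun_prop) (by fun_prop) (by fun_prop) ?_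
      intro f hf
      rw [rA_big f hf.ge, rB_small f hf.le, wlr]⟩
  let ii : C(Wd (geomReal S) vA (geomReal Z) vB, geomReal X) := wdesc iA iB rfl
  have ds : bs b (dirac v) = 1 := bs_dirac hv
  refine ⟨⟨r, ii, ?_, ?_⟩⟩
  · have k1 : (ii.comp r).HomotopicRel eX ∅ := by
      refine contig dX _ _ _ (by simp) ?_
      intro f
      obtain ⟨τ, hτ, hs⟩ := gr_supp f.2
      have hs' := fun w => (hs w).2
      have hval : (ii.comp r) f = if bs b f.1 ≤ 1 / 3 then iA (rA f) else iB (rB f) := by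
        simp only [r, ii, comp_apply, ContinuousMap.coe_mk]
        split_ifs <;> rfl
      rw [hval]
      by_cases h0 : bs b f.1 = 0
      · rw [if_pos (by rw [h0]; norm_num)]
        exact ⟨τ, hτ, pA_supp2 hs' (Or.inl h0), pE_supp hs'⟩
      · have hZ := h4 τ hτ (hpos f.1 τ hs h0)
        rcases le_total (bs b f.1) (2 / 3) with h | h
        · refine ⟨insert v (τ \ b), hZX (h6 τ hZ), ?_, pE_supp1 hs' h⟩
          split_ifs
          · exact pA_supp1 hs'
          · exact pB_supp1 hs' h
        · refine ⟨τ, hτ, ?_, pE_supp hs'⟩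
          rw [if_neg (by linarith)]
          exact pB_supp2 hs' h
    have k2 : eX.HomotopicRel (ContinuousMap.id _) ∅ := by
      refine contig dX _ _ _ (by simp) ?_
      intro f
      obtain ⟨τ, hτ, hs⟩ := gr_supp f.2
      have hs' := fun w => (hs w).2
      exact ⟨τ, hτ, pE_supp hs', hs'⟩
    exact (k1.trans k2).homotopic
  · apply wd_homotopic_rel
    · have g1 : (rB.comp iA).HomotopicRel (ContinuousMap.const _ vB) {f | rB (iA f) = vB} := by
        refine contig dZ _ _ _ (fun x hx => hx) ?_
        intro f
        by_cases h : bs b f.1 ≤ 1 / 3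
        · refine ⟨{v}, hvZ, ?_, ?_⟩
          · rw [ContinuousMap.comp_apply, rB_small (iA f) h]
            intro w hw; by_contra hc
            simp at hc; simp [hvB, dirac, hc] at hw
          · intro w hw; by_contra hc
            simp at hc; simp [hvB, dirac, hc] at hw
        · obtain ⟨τ, hτ, hs⟩ := gr_supp f.2
          have hne := hpos f.1 τ hs (by intro h'; rw [h'] at h; norm_num at h)
          have hZ := h4 τ (hSX hτ) hne
          have hvτ : v ∈ τ := by
            obtain ⟨w, hw, hwb⟩ := hne
            rwa [← h2 τ hτ w hw hwb]
          have hs' := fun w => (hs w).2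
          refine ⟨τ, hZ, ?_, ?_⟩
          · rcases le_total (bs b f.1) (2 / 3) with h | h
            · intro w hw
              have := pB_supp1 hs' h w hw
              simp at this
              rcases this with rfl | this
              · exact hvτ
              · exact this.1
            · exact pB_supp2 hs' h
          · intro w hw; by_contra hc
            have : w ≠ v := by rintro rfl; exact hc hvτ
            simp [hvB, dirac, this] at hw
      obtain ⟨G⟩ := g1
      have k1 : ((r.comp ii).comp (wl vA vB)).HomotopicRel ((wl vA vB).comp (rA.comp iA)) {vA} := by
        refine ⟨{
          toFun := fun q => if bs b q.2.1 ≤ 1 / 3 then wl vA vB (rA (iA q.2)) else wr vA vB (G q)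
          continuous_toFun := by
            refine Continuous.if_le (by fun_prop) (by fun_prop) (by fun_prop) (by fun_prop) ?_
            rintro ⟨t, f⟩ hf
            have e1 := rA_big (iA f) hf.ge
            have e2 := rB_small (iA f) hf.le
            rw [G.eq_fst t (x := f) e2, e1, ContinuousMap.comp_apply, e2, wlr]
          map_zero_left := ?_
          map_one_left := ?_
          prop' := ?_ }⟩
        · intro f
          simp only [G.apply_zero]
          rfl
        · intro f
          simp only [G.apply_one]
          split_ifs with h
          · rfl
          · have e1 := rA_big (iA f) (not_le.1 h).le
            simp [e1, wlr]
        · rintro t f rfl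
          have e2 : rB (iA vA) = vB := Subtype.ext (pB_dirac hv)
          simp only [ContinuousMap.coe_mk]
          have hn : ¬ (bs b vA.1 ≤ 1 / 3) := by
            simp only [hvA, ds]; norm_num
          rw [if_neg hn, G.eq_fst t (x := vA) e2]
          show _ = (if bs b vA.1 ≤ 1 / 3 then _ else _)
          rw [if_neg hn]
          rfl
      have k2 : (rA.comp iA).HomotopicRel (ContinuousMap.id _) {vA} := by
        refine contig dS _ _ _ ?_ ?_
        · rintro x rfl
          exact Subtype.ext (pA_dirac hv)
        · intro f
          obtain ⟨τ, hτ, hs⟩ := gr_supp f.2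
          have hs' := fun w => (hs w).2
          refine ⟨τ, hτ, pA_supp2 hs' ?_, hs'⟩
          by_cases h0 : bs b f.1 = 0
          · exact Or.inl h0
          · obtain ⟨w, hw, hwb⟩ := hpos f.1 τ hs h0
            right
            rwa [← h2 τ hτ w hw hwb]
      exact k1.trans (k2.comp_continuousMap (wl vA vB))
    · have g1 : (rA.comp iB).HomotopicRel (ContinuousMap.const _ vA) {f | rA (iB f) = vA} := by
        refine contig dS _ _ _ (fun x hx => hx) ?_
        intro f
        obtain ⟨τ, hτ, hs⟩ := gr_supp f.2
        have hs' := fun w => (hs w).2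
        refine ⟨insert v (τ \ b), h5 τ hτ, pA_supp1 hs', ?_⟩
        intro w hw; by_contra hc
        have : w ≠ v := by rintro rfl; exact hc (by simp)
        simp [hvA, dirac, this] at hw
      obtain ⟨G⟩ := g1
      have k1 : ((r.comp ii).comp (wr vA vB)).HomotopicRel ((wr vA vB).comp (rB.comp iB)) {vB} := by
        refine ⟨{
          toFun := fun q => if bs b q.2.1 ≤ 1 / 3 then wl vA vB (G q) else wr vA vB (rB (iB q.2))
          continuous_toFun := by
            refine Continuous.if_le (by fun_prop) (by fun_prop) (by fun_prop) (by fun_prop) ?_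
            rintro ⟨t, f⟩ hf
            have e1 := rA_big (iB f) hf.ge
            have e2 := rB_small (iB f) hf.le
            rw [G.eq_fst t (x := f) e1, e2, ContinuousMap.comp_apply, e1, wlr]
          map_zero_left := ?_
          map_one_left := ?_
          prop' := ?_ }⟩
        · intro f
          simp only [G.apply_zero]
          rfl
        · intro f
          simp only [G.apply_one]
          split_ifs with h
          · have e1 := rB_small (iB f) h
            simp [e1, wlr]
          · rfl
        · rintro t f rfl
          simp only [ContinuousMap.coe_mk]
          have hn : ¬ (bs b vB.1 ≤ 1 / 3) := by
            simp only [hvB, ds]; norm_num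
          rw [if_neg hn]
          show _ = (if bs b vB.1 ≤ 1 / 3 then _ else _)
          rw [if_neg hn]
          rfl
      have k2 : (rB.comp iB).HomotopicRel eZ {vB} := by
        refine contig dZ _ _ _ ?_ ?_
        · rintro x rfl
          exact Subtype.ext ((pB_dirac hv).trans (pE_dirac hv).symm)
        · intro f
          obtain ⟨τ, hτ, hs⟩ := gr_supp f.2
          have hs' := fun w => (hs w).2
          rcases le_total (bs b f.1) (2 / 3) with h | h
          · exact ⟨_, h6 τ hτ, pB_supp1 hs' h, pE_supp1 hs' h⟩
          · exact ⟨τ, hτ, pB_supp2 hs' h, pE_supp hs'⟩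
      have k3 : eZ.HomotopicRel (ContinuousMap.id _) {vB} := by
        refine contig dZ _ _ _ ?_ ?_
        · rintro x rfl
          exact Subtype.ext (pE_dirac hv)
        · intro f
          obtain ⟨τ, hτ, hs⟩ := gr_supp f.2
          have hs' := fun w => (hs w).2
          exact ⟨τ, hτ, pE_supp hs', hs'⟩
      exact k1.trans ((k2.trans k3).comp_continuousMap (wr vA vB))

end SubstHE


namespace SubstHE
open ContinuousMap
open scoped unitInterval

section wf
variable {ι : Type} {X : ι → Type} [∀ o, TopologicalSpace (X o)] {p : ∀ o, X o}
  {Y : Type} [TopologicalSpace Y]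

def wj (p : ∀ o, X o) (o : ι) : C(X o, WedgeFam X p) :=
  ⟨fun x => Quot.mk _ ⟨o, x⟩, continuous_quot_mk.comp continuous_sigmaMk⟩

theorem wj_base (o o' : ι) : wj p o (p o) = wj p o' (p o') :=
  Quot.sound ⟨⟨o, rfl⟩, ⟨o', rfl⟩⟩

def wfdesc (f : ∀ o, C(X o, Y)) (h : ∀ o o', f o (p o) = f o' (p o')) : C(WedgeFam X p, Y) :=
  ⟨Quot.lift (fun a => f a.1 a.2) (by
    rintro _ _ ⟨⟨o, rfl⟩, ⟨o', rfl⟩⟩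
    exact h o o'), continuous_quot_lift _ (by
      rw [continuous_sigma_iff]
      intro o
      exact (f o).continuous)⟩

@[simp] theorem wfdesc_wj (f : ∀ o, C(X o, Y)) (h : ∀ o o', f o (p o) = f o' (p o')) (o : ι)
    (x : X o) : wfdesc f h (wj p o x) = f o x := rfl

theorem wf_cases {P : WedgeFam X p → Prop} (w : WedgeFam X p) (h : ∀ o x, P (wj p o x)) : P w := by
  induction w using Quot.ind with
  | mk a => exact h a.1 a.2

theorem wf_hep (o0 : ι) (h : ∀ o, HEP (X o) (p o)) : HEP (WedgeFam X p) (wj p o0 (p o0)) := by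
  intro Y _ g γ h0
  choose H H0 Hb using fun o => h o Y (g.comp (wj p o)) γ (by
    rw [h0, comp_apply, wj_base o0 o])
  refine ⟨wfdesc H (fun o o' => by rw [Hb, Hb]), ?_, ?_⟩
  · intro w
    induction w using wf_cases with
    | h o x => exact H0 o x
  · exact Hb o0

theorem wf_joined (o0 : ι) (h : ∀ o x, Joined x (p o)) (w : WedgeFam X p) :
    Joined w (wj p o0 (p o0)) := by
  induction w using wf_cases with
  | h o x =>
    rw [← wj_base o o0]
    exact (h o x).map (wj p o).continuous

theorem wf_unique (o0 : ι) (h : ∀ o, o = o0) : Nonempty (X o0 ≃ₕ WedgeFam X p) := by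
  have : ∀ o, ∃ f : C(X o, X o0), f (p o) = p o0 ∧ (∀ x, wj p o0 (f x) = wj p o x) ∧
      ∀ e : o = o0, ∀ x, f x = e ▸ x := by
    intro o
    obtain rfl := h o
    exact ⟨ContinuousMap.id _, rfl, fun x => rfl, fun e x => rfl⟩
  choose f hf1 hf2 hf3 using this
  refine ⟨⟨wj p o0, wfdesc f (fun o o' => by rw [hf1, hf1]), ?_, ?_⟩⟩
  · convert Homotopic.refl _ using 1
    ext x
    simp [hf3 o0 rfl]
  · convert Homotopic.refl _ using 1
    ext w
    induction w using wf_cases with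
    | h o x => exact (hf2 o x).symm

abbrev WP (p : ∀ o, X o) (P : ι → Prop) : Type :=
  WedgeFam (fun o : {o // P o} => X o.1) (fun o => p o.1)

theorem wf_all (P : ι → Prop) (h : ∀ o, P o) : Nonempty (WP p P ≃ₕ WedgeFam X p) := by
  refine ⟨⟨wfdesc (fun o => wj p o.1) (fun o o' => wj_base _ _),
    wfdesc (fun o => wj (fun o : {o // P o} => p o.1) ⟨o, h o⟩) (fun o o' =>
      wj_base (p := fun o : {o // P o} => p o.1) _ _), ?_, ?_⟩⟩
  all_goals
    convert Homotopic.refl _ using 1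
    ext w
    induction w using wf_cases with
    | h o x => rfl

theorem wf_add (P P' : ι → Prop) (o0 o1 : ι) (h0 : P o0) (h1 : ¬ P o1)
    (h : ∀ o, P' o ↔ (P o ∨ o = o1)) :
    Nonempty (Wd (WP p P) (wj (fun o : {o // P o} => p o.1) ⟨o0, h0⟩ (p o0)) (X o1) (p o1) ≃ₕ
      WP p P') := by
  set q := fun o : {o // P o} => p o.1
  set q' := fun o : {o // P' o} => p o.1
  set a := wj q ⟨o0, h0⟩ (p o0) with ha
  have hP' : ∀ o, P o → P' o := fun o ho => (h o).2 (Or.inl ho)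
  have ho1 : P' o1 := (h o1).2 (Or.inr rfl)
  have : ∀ o : {o // P' o}, ∃ f : C(X o.1, Wd (WP p P) a (X o1) (p o1)),
      (f (p o.1) = wl a (p o1) a) ∧
      (∀ ho : P o.1, ∀ x, f x = wl a (p o1) (wj q ⟨o.1, ho⟩ x)) ∧
      (∀ e : o1 = o.1, ∀ x : X o1, f (e ▸ x) = wr a (p o1) x) := by
    rintro ⟨o, ho⟩
    by_cases hP : P o
    · refine ⟨(wl a (p o1)).comp (wj q ⟨o, hP⟩), ?_, fun _ x => rfl, ?_⟩
      · rw [comp_apply, ha]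
        exact congrArg _ (wj_base (p := q) ⟨o, hP⟩ ⟨o0, h0⟩)
      · intro e x
        exfalso
        have e1 : o1 = o := e
        rw [← e1] at hP
        exact h1 hP
    · have e : o = o1 := by
        rcases (h o).1 ho with h | h
        · exact absurd h hP
        · exact h
      subst e
      exact ⟨wr a (p o), (wlr _ _).symm, fun h' => absurd h' hP, fun e x => rfl⟩
  choose f hf1 hf2 hf3 using this
  let F : C(Wd (WP p P) a (X o1) (p o1), WP p P') :=
    wdesc (wfdesc (fun o => wj q' ⟨o.1, hP' _ o.2⟩) (fun o o' => wj_base (p := q') _ _))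
      (wj q' ⟨o1, ho1⟩) (wj_base (p := q') _ _)
  let G : C(WP p P', Wd (WP p P) a (X o1) (p o1)) := wfdesc f (fun o o' => by
    rw [hf1, hf1])
  refine ⟨⟨F, G, ?_, ?_⟩⟩
  · convert Homotopic.refl _ using 1
    ext w
    induction w using wd_cases with
    | h1 w =>
      induction w using wf_cases with
      | h o x => exact (hf2 ⟨o.1, hP' _ o.2⟩ o.2 x).symm
    | h2 x => exact (hf3 ⟨o1, ho1⟩ rfl x).symm
  · convert Homotopic.refl _ using 1
    ext w
    induction w using wf_cases with
    | h o x =>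
      obtain ⟨o, ho⟩ := o
      show _ = F (f ⟨o, ho⟩ x)
      by_cases hP : P o
      · rw [hf2 ⟨o, ho⟩ hP x]; rfl
      · have e : o = o1 := by
          rcases (h o).1 ho with h | h
          · exact absurd h hP
          · exact h
        subst e
        have := hf3 ⟨o, ho⟩ rfl x
        dsimp only at this
        rw [this]; rfl

end wf
end SubstHE


namespace SubstHE
open ContinuousMap

section comb
variable {m : ℕ} {n : Fin m → ℕ}

theorem mem_projC {sg : Finset ((i : Fin m) × Fin (n i))} {i : Fin m} {j : Fin (n i)} :
    j ∈ projC sg i ↔ (⟨i, j⟩ : (i : Fin m) × Fin (n i)) ∈ sg := by simp [projC]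

theorem mem_suppC {sg : Finset ((i : Fin m) × Fin (n i))} {i : Fin m} :
    i ∈ suppC sg ↔ ∃ j, (⟨i, j⟩ : (i : Fin m) × Fin (n i)) ∈ sg := by
  simp [suppC, Finset.Nonempty, mem_projC]

theorem projC_mono {sg τ : Finset ((i : Fin m) × Fin (n i))} (h : τ ⊆ sg) (i : Fin m) :
    projC τ i ⊆ projC sg i := fun j hj => by
  rw [mem_projC] at *; exact h hj

theorem suppC_mono {sg τ : Finset ((i : Fin m) × Fin (n i))} (h : τ ⊆ sg) :
    suppC τ ⊆ suppC sg := fun j hj => by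
  rw [mem_suppC] at *
  obtain ⟨k, hk⟩ := hj
  exact ⟨k, h hk⟩

theorem substC_down {K : Set (Finset (Fin m))} (hK : DownC K)
    {F : ∀ i, Set (Finset (Fin (n i)))} (hF : ∀ i, DownC (F i)) : DownC (substC K F) := by
  intro sg hs τ hτ
  exact ⟨hK _ hs.1 _ (suppC_mono hτ), fun i => hF i _ (hs.2 i) _ (projC_mono hτ i)⟩

/-- the hypotheses on the data, bundled -/
structure Dat (K : Set (Finset (Fin m))) (Ks : ∀ i, Set (Finset (Fin (n i))))
    (fam : ℕ → ∀ i : Fin m, Set (Finset (Fin (n i)))) [∀ i, NeZero (n i)]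
    (Z : Fin m → Set (Finset ((i : Fin m) × Fin (n i)))) : Prop where
  dK : DownC K
  vK : ∀ v : Fin m, {v} ∈ K
  dF : ∀ t i, DownC (fam t i)
  zF : ∀ t i, ∀ τ : Finset (Fin (n i)), τ ⊆ {0} → τ ∈ fam t i
  ne : ∀ i k : Fin m, k ≠ i → fam (i + 1) k = fam i k
  e1 : ∀ i : Fin m, fam (i + 1) i = Ks i
  e0 : ∀ i : Fin m, fam i i = {τ | τ ⊆ {0}}
  z0 : ∀ i : Fin m, fam 0 i = {τ | τ ⊆ {0}}
  Z : ∀ i sg, sg ∈ Z i ↔ insert i (suppC sg) ∈ K ∧ (∀ k, projC sg k ∈ fam (i + 1) k)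

theorem mk_dat [∀ i, NeZero (n i)]
    (K : Set (Finset (Fin m))) (hK : IsComplex K)
    (hKvert : ∀ v : Fin m, {v} ∈ K)
    (Ks : ∀ i, Set (Finset (Fin (n i)))) (hKs : ∀ i, IsComplex (Ks i))
    (hvert : ∀ i (j : Fin (n i)), ({j} : Finset (Fin (n i))) ∈ Ks i)
    (fam : ℕ → ∀ i : Fin m, Set (Finset (Fin (n i))))
    (hfam : ∀ t (i : Fin m), fam t i = if (i : ℕ) < t then Ks i else {τ | τ ⊆ {0}})
    (Z : Fin m → Set (Finset ((i : Fin m) × Fin (n i))))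
    (hZ : ∀ i, Z i = {sg | ∃ τ ρ, τ ∈ linkC (substC K (fam i)) ⟨i, 0⟩ ∧ ρ ∈ Ks i ∧
      sg = τ ∪ ρ.image (Sigma.mk i)}) : Dat K Ks fam Z := by
  have dF : ∀ t i, DownC (fam t i) := by
    intro t i
    rw [hfam]
    split_ifs
    · exact (hKs i).2
    · intro sg hs τ hτ
      exact hτ.trans hs
  have ne : ∀ i k : Fin m, k ≠ i → fam (i + 1) k = fam i k := by
    intro i k hk
    rw [hfam, hfam]
    have : (k : ℕ) ≠ i := fun h => hk (Fin.ext h)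
    have : (k : ℕ) < i + 1 ↔ (k : ℕ) < i := by omega
    simp only [this]
  have e1 : ∀ i : Fin m, fam (i + 1) i = Ks i := by
    intro i; rw [hfam]; simp
  have e0 : ∀ i : Fin m, fam i i = {τ | τ ⊆ {0}} := by
    intro i; rw [hfam]; simp
  refine ⟨hK.2, hKvert, dF, ?_, ne, e1, e0, ?_, ?_⟩
  · intro t i τ hτ
    rw [hfam]
    split_ifs
    · exact (hKs i).2 _ (hvert i 0) _ hτ
    · exact hτ
  · intro i; rw [hfam]; simp
  · intro i sg
    rw [hZ]
    constructor
    · rintro ⟨τ, ρ, ⟨hτ, hvτ, hi⟩, hρ, rfl⟩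
      refine ⟨hK.2 _ hi.1 _ ?_, ?_⟩
      · intro k hk
        rw [Finset.mem_insert, mem_suppC] at hk
        rw [mem_suppC]
        by_cases hki : k = i
        · subst hki; exact ⟨0, by simp⟩
        · obtain ⟨j, hj⟩ := hk.resolve_left hki
          refine ⟨j, ?_⟩
          simp only [Finset.mem_union, Finset.mem_image] at hj
          rcases hj with hj | ⟨a, _, ha⟩
          · exact Finset.mem_insert_of_mem hj
          · exact absurd (congrArg Sigma.fst ha).symm hki
      · intro k
        by_cases hki : k = i
        · subst hki
          rw [e1]
          refine (hKs k).2 _ hρ _ ?_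
          intro j hj
          rw [mem_projC, Finset.mem_union, Finset.mem_image] at hj
          rcases hj with hj | ⟨a, h, ha⟩
          · exfalso
            have := hτ.2 k
            rw [e0] at this
            have h0 := this (mem_projC.2 hj)
            rw [Finset.mem_singleton] at h0
            subst h0
            exact hvτ hj
          · obtain rfl : a = j := by simpa using ha
            exact h
        · rw [ne i k hki]
          refine dF _ _ _ (hτ.2 k) _ ?_
          intro j hj
          rw [mem_projC, Finset.mem_union, Finset.mem_image] at hj
          rw [mem_projC]
          rcases hj with hj | ⟨a, h, ha⟩
          · exact hj
          · exact absurd (congrArg Sigma.fst ha).symm hki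
    · rintro ⟨h1, h2⟩
      have hmem : ∀ τ : Finset ((i : Fin m) × Fin (n i)), τ ⊆ insert ⟨i, 0⟩ (sg.filter (·.1 ≠ i)) →
          τ ∈ substC K (fam i) := by
        intro τ hτ
        constructor
        · refine hK.2 _ h1 _ ?_
          intro k hk
          obtain ⟨j, hj⟩ := mem_suppC.1 hk
          have := hτ hj
          rw [Finset.mem_insert, Finset.mem_filter] at this
          rw [Finset.mem_insert, mem_suppC]
          rcases this with h | h
          · exact Or.inl (congrArg Sigma.fst h)
          · exact Or.inr ⟨j, h.1⟩
        · intro k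
          by_cases hki : k = i
          · subst hki
            rw [e0]
            intro j hj
            have := hτ (mem_projC.1 hj)
            rw [Finset.mem_insert, Finset.mem_filter] at this
            simpa using this
          · rw [← ne i k hki]
            refine dF _ _ _ (h2 k) _ ?_
            intro j hj
            have := hτ (mem_projC.1 hj)
            rw [Finset.mem_insert, Finset.mem_filter] at this
            rw [mem_projC]
            rcases this with h | h
            · exact absurd (congrArg Sigma.fst h) hki
            · exact h.1
      refine ⟨sg.filter (·.1 ≠ i), projC sg i, ⟨hmem _ (Finset.subset_insert _ _), ?_,
        hmem _ (Finset.Subset.refl _)⟩, ?_, ?_⟩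
      · simp
      · rw [← e1]; exact h2 i
      · ext ⟨k, j⟩
        rw [Finset.mem_union, Finset.mem_filter, Finset.mem_image]
        constructor
        · intro h
          by_cases hki : k = i
          · subst hki
            exact Or.inr ⟨j, mem_projC.2 h, rfl⟩
          · exact Or.inl ⟨h, hki⟩
        · rintro (h | ⟨a, ha, e⟩)
          · exact h.1
          · rw [← e]; exact mem_projC.1 ha

variable [∀ i, NeZero (n i)] {K : Set (Finset (Fin m))} {Ks : ∀ i, Set (Finset (Fin (n i)))}
    {fam : ℕ → ∀ i : Fin m, Set (Finset (Fin (n i)))}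
    {Z : Fin m → Set (Finset ((i : Fin m) × Fin (n i)))}

theorem Dat.dZ (D : Dat K Ks fam Z) (i : Fin m) : DownC (Z i) := by
  intro sg hs τ hτ
  rw [D.Z] at *
  exact ⟨D.dK _ hs.1 _ (Finset.insert_subset_insert _ (suppC_mono hτ)), fun k =>
    D.dF _ _ _ (hs.2 k) _ (projC_mono hτ k)⟩

theorem Dat.dS (D : Dat K Ks fam Z) (t : ℕ) : DownC (substC K (fam t)) :=
  substC_down D.dK (D.dF t)

/-- vertex at zero of a block -/
theorem Dat.v0 (D : Dat K Ks fam Z) (t : ℕ) (τ : Finset ((i : Fin m) × Fin (n i)))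
    (h : ∀ w ∈ τ, w.2 = 0) (hs : suppC τ ∈ K) : τ ∈ substC K (fam t) := by
  refine ⟨hs, fun k => D.zF _ _ _ ?_⟩
  intro j hj
  have := h _ (mem_projC.1 hj)
  simpa using this

theorem Dat.v1 (D : Dat K Ks fam Z) (i : Fin m) (τ : Finset ((i : Fin m) × Fin (n i)))
    (h : ∀ w ∈ τ, w.2 = 0) (hs : insert i (suppC τ) ∈ K) : τ ∈ Z i := by
  rw [D.Z]
  refine ⟨hs, fun k => D.zF _ _ _ ?_⟩
  intro j hj
  have := h _ (mem_projC.1 hj)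
  simpa using this

theorem suppC_sing (i : Fin m) (j : Fin (n i)) :
    suppC ({⟨i, j⟩} : Finset ((i : Fin m) × Fin (n i))) = {i} := by
  ext k
  rw [mem_suppC, Finset.mem_singleton]
  constructor
  · rintro ⟨j', h⟩
    exact congrArg Sigma.fst (Finset.mem_singleton.1 h)
  · rintro rfl; exact ⟨j, by simp⟩

theorem Dat.vS (D : Dat K Ks fam Z) (t : ℕ) (i : Fin m) : {⟨i, 0⟩} ∈ substC K (fam t) :=
  D.v0 t _ (by simp) (by rw [suppC_sing]; exact D.vK i)

theorem Dat.vZ (D : Dat K Ks fam Z) (i : Fin m) : {⟨i, 0⟩} ∈ Z i :=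
  D.v1 i _ (by simp) (by rw [suppC_sing]; simpa using D.vK i)

theorem Dat.step (D : Dat K Ks fam Z) (i : Fin m) :
    Nonempty (geomReal (substC K (fam (i + 1))) ≃ₕ
      Wd (geomReal (substC K (fam i))) ⟨dirac ⟨i, 0⟩, dirac_mem (D.dS i) (D.vS i i)⟩
        (geomReal (Z i)) ⟨dirac ⟨i, 0⟩, dirac_mem (D.dZ i) (D.vZ i)⟩) := by
  have hins : ∀ τ ∈ Z i, ∀ t : ℕ, (t = i ∨ t = i + 1) →
      insert (⟨i, 0⟩ : (i : Fin m) × Fin (n i)) (τ \ Finset.univ.filter (·.1 = i)) ∈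
        substC K (fam t) := by
    intro τ hτ t ht
    rw [D.Z] at hτ
    constructor
    · refine D.dK _ hτ.1 _ ?_
      intro k hk
      obtain ⟨j, hj⟩ := mem_suppC.1 hk
      rw [Finset.mem_insert, Finset.mem_sdiff] at hj
      rw [Finset.mem_insert, mem_suppC]
      rcases hj with h | h
      · exact Or.inl (congrArg Sigma.fst h)
      · exact Or.inr ⟨j, h.1⟩
    · intro k
      by_cases hki : k = i
      · subst hki
        apply D.zF
        intro j hj
        have := mem_projC.1 hj
        simpa using this
      · have : fam t k = fam (i + 1) k := by
          rcases ht with h | h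
          · rw [h, D.ne i k hki]
          · rw [h]
        rw [this]
        refine D.dF _ _ _ (hτ.2 k) _ ?_
        intro j hj
        have := mem_projC.1 hj
        rw [Finset.mem_insert, Finset.mem_sdiff] at this
        rw [mem_projC]
        rcases this with h | h
        · exact absurd (congrArg Sigma.fst h) hki
        · exact h.1
  have hX : ∀ τ ∈ substC K (fam (i + 1)), i ∈ suppC τ → τ ∈ Z i := by
    intro τ hτ hi
    rw [D.Z, Finset.insert_eq_of_mem hi]
    exact hτ
  refine SubstHE.step (Finset.univ.filter (·.1 = i)) ⟨i, 0⟩ (by simp) _ _ _ (D.dS i) (D.dZ i)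
    (D.dS (i + 1)) ?_ ?_ ?_ ?_ ?_ (fun τ hτ => hins τ hτ _ (Or.inl rfl)) ?_ (D.vS i i) (D.vZ i)
  · intro τ hτ
    refine ⟨hτ.1, fun k => ?_⟩
    by_cases hki : k = i
    · subst hki
      have := hτ.2 k
      rw [D.e0] at this
      exact D.zF _ _ _ this
    · rw [D.ne i k hki]; exact hτ.2 k
  · intro τ hτ
    rw [D.Z] at hτ
    exact ⟨D.dK _ hτ.1 _ (Finset.subset_insert _ _), hτ.2⟩
  · rintro τ hτ ⟨k, j⟩ hw hb
    obtain rfl : k = i := by simpa using hb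
    have := hτ.2 k
    rw [D.e0] at this
    have := this (mem_projC.2 hw)
    rw [Finset.mem_singleton] at this
    rw [this]
  · intro τ hτ hb
    refine ⟨hτ.1, fun k => ?_⟩
    by_cases hki : k = i
    · subst hki
      apply D.zF
      intro j hj
      exact absurd (by simp) (hb _ (mem_projC.1 hj))
    · rw [← D.ne i k hki]; exact hτ.2 k
  · rintro τ hτ ⟨⟨k, j⟩, hw, hb⟩
    obtain rfl : k = i := by simpa using hb
    exact hX τ hτ (mem_suppC.2 ⟨j, hw⟩)
  · intro τ hτ
    exact hX _ (hins τ hτ _ (Or.inr rfl)) (mem_suppC.2 ⟨0, by simp⟩)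

end comb
end SubstHE


namespace SubstHE
open ContinuousMap

section geo
variable {m : ℕ} {n : Fin m → ℕ} [∀ i, NeZero (n i)] {K : Set (Finset (Fin m))}
    {Ks : ∀ i, Set (Finset (Fin (n i)))}
    {fam : ℕ → ∀ i : Fin m, Set (Finset (Fin (n i)))}
    {Z : Fin m → Set (Finset ((i : Fin m) × Fin (n i)))}

theorem Dat.zjoin (D : Dat K Ks fam Z) {i j : Fin m} (hij : j ≠ i) (h : {i, j} ∈ K)
    (f : geomReal (Z i)) :
    Joined f ⟨dirac ⟨i, 0⟩, dirac_mem (D.dZ i) (D.vZ i)⟩ := by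
  obtain ⟨sg, hsg, hs⟩ := gr_supp f.2
  obtain ⟨u, hu1, hu2⟩ : ∃ u, insert u sg ∈ Z i ∧ {u, ⟨i, 0⟩} ∈ Z i := by
    by_cases hex : ∃ w ∈ sg, w.1 ≠ i
    · obtain ⟨⟨k, l⟩, hw, hk⟩ := hex
      refine ⟨⟨k, l⟩, by rwa [Finset.insert_eq_of_mem hw], ?_⟩
      rw [D.Z] at hsg ⊢
      constructor
      · refine D.dK _ hsg.1 _ ?_
        intro a ha
        rw [Finset.mem_insert] at ha ⊢
        rcases ha with ha | ha
        · exact Or.inl ha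
        · obtain ⟨b, hb⟩ := mem_suppC.1 ha
          rw [Finset.mem_insert, Finset.mem_singleton] at hb
          rcases hb with hb | hb
          · obtain rfl : a = k := congrArg Sigma.fst hb
            exact Or.inr (mem_suppC.2 ⟨l, hw⟩)
          · exact Or.inl (congrArg Sigma.fst hb)
      · intro a
        by_cases hai : a = i
        · subst hai
          apply D.zF
          intro b hb
          have hb := mem_projC.1 hb
          rw [Finset.mem_insert, Finset.mem_singleton] at hb
          rcases hb with hb | hb
          · exact absurd (congrArg Sigma.fst hb).symm hk
          · simpa using hb
        · refine D.dF _ _ _ (hsg.2 a) _ ?_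
          intro b hb
          have hb := mem_projC.1 hb
          rw [Finset.mem_insert, Finset.mem_singleton] at hb
          rcases hb with hb | hb
          · rw [mem_projC, hb]; exact hw
          · exact absurd (congrArg Sigma.fst hb) hai
    · push Not at hex
      refine ⟨⟨j, 0⟩, ?_, ?_⟩
      · rw [D.Z] at hsg ⊢
        constructor
        · refine D.dK _ h _ ?_
          intro a ha
          rw [Finset.mem_insert] at ha
          rw [Finset.mem_insert, Finset.mem_singleton]
          rcases ha with ha | ha
          · exact Or.inl ha
          · obtain ⟨b, hb⟩ := mem_suppC.1 ha
            rw [Finset.mem_insert] at hb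
            rcases hb with hb | hb
            · exact Or.inr (congrArg Sigma.fst hb)
            · exact Or.inl (hex _ hb)
        · intro a
          by_cases hai : a = i
          · refine D.dF _ _ _ (hsg.2 a) _ ?_
            intro b hb
            have hb := mem_projC.1 hb
            rw [Finset.mem_insert] at hb
            rcases hb with hb | hb
            · exact absurd ((congrArg Sigma.fst hb).symm.trans hai) hij
            · exact mem_projC.2 hb
          · apply D.zF
            intro b hb
            have hb := mem_projC.1 hb
            rw [Finset.mem_insert] at hb
            rcases hb with hb | hb
            · obtain rfl : a = j := congrArg Sigma.fst hb
              simpa using hb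
            · exact absurd (hex _ hb) hai
      · apply D.v1
        · intro w hw
          rw [Finset.mem_insert, Finset.mem_singleton] at hw
          rcases hw with rfl | rfl <;> rfl
        · refine D.dK _ h _ ?_
          intro a ha
          rw [Finset.mem_insert] at ha
          rw [Finset.mem_insert, Finset.mem_singleton]
          rcases ha with ha | ha
          · exact Or.inl ha
          · obtain ⟨b, hb⟩ := mem_suppC.1 ha
            rw [Finset.mem_insert, Finset.mem_singleton] at hb
            rcases hb with hb | hb
            · exact Or.inr (congrArg Sigma.fst hb)
            · exact Or.inl (congrArg Sigma.fst hb)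
  have hu : {u} ∈ Z i := D.dZ i _ hu2 _ (by simp)
  have hd : ∀ u w : (i : Fin m) × Fin (n i), dirac u w ≠ 0 → w = u := by
    intro u w h
    by_contra hc
    simp [dirac, hc] at h
  refine Joined.trans (y := ⟨dirac u, dirac_mem (D.dZ i) hu⟩) ?_ ?_
  · refine gr_joined (D.dZ i) _ _ hu1 ?_ ?_
    · intro w hw
      exact Finset.mem_insert_of_mem ((hs w).2 hw)
    · intro w hw
      rw [hd _ _ hw]; simp
  · refine gr_joined (D.dZ i) _ _ hu2 ?_ ?_
    · intro w hw
      rw [hd _ _ hw]; simp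
    · intro w hw
      rw [hd _ _ hw]; simp

theorem adj (dK : DownC K) (vK : ∀ v : Fin m, {v} ∈ K) [hc : PathConnectedSpace ↥(geomReal K)]
    (i j : Fin m) (hij : j ≠ i) : ∃ k, k ≠ i ∧ {i, k} ∈ K := by
  let φ : geomReal K → ℝ := fun f => f.1 i
  have hφ : Continuous φ := (continuous_apply i).comp continuous_subtype_val
  have h1 : φ ⟨dirac i, dirac_mem dK (vK i)⟩ = 1 := by simp [φ, dirac]
  have h0 : φ ⟨dirac j, dirac_mem dK (vK j)⟩ = 0 := by simp [φ, dirac, hij.symm]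
  obtain ⟨f, hf⟩ := mem_range_of_exists_le_of_exists_ge hφ (c := 1 / 2)
    ⟨_, by rw [h0]; norm_num⟩ ⟨_, by rw [h1]; norm_num⟩
  have hf : f.1 i = 1 / 2 := hf
  obtain ⟨sg, hsg, hs⟩ := gr_supp f.2
  have : ∃ k, k ≠ i ∧ f.1 k ≠ 0 := by
    by_contra hcc
    push Not at hcc
    have := gr_sum f.2
    rw [Finset.sum_eq_single i (fun k _ hk => hcc k hk) (by simp), hf] at this
    norm_num at this
  obtain ⟨k, hk, hfk⟩ := this
  refine ⟨k, hk, dK _ hsg _ ?_⟩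
  intro a ha
  rw [Finset.mem_insert, Finset.mem_singleton] at ha
  rcases ha with rfl | rfl
  · rw [hs, hf]; norm_num
  · rw [hs]; exact hfk

theorem Dat.base (D : Dat K Ks fam Z) :
    Nonempty (geomReal (substC K (fam 0)) ≃ₕ geomReal K) := by
  have key : ∀ g ∈ geomReal (substC K (fam 0)), ∀ (i : Fin m) (j : Fin (n i)), j ≠ 0 →
      g ⟨i, j⟩ = 0 := by
    intro g hg i j hj
    by_contra hc
    obtain ⟨sg, hsg, hs⟩ := gr_supp hg
    have := hsg.2 i
    rw [D.z0] at this
    have := this (mem_projC.2 ((hs _).2 hc))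
    exact hj (by simpa using this)
  have hF : ∀ g ∈ geomReal (substC K (fam 0)), (fun i => g ⟨i, 0⟩) ∈ geomReal K := by
    intro g hg
    obtain ⟨sg, hsg, hs⟩ := gr_supp hg
    refine gr_mem D.dK (fun v => gr_nonneg hg _) ?_ hsg.1 ?_
    · rw [← gr_sum hg, Fintype.sum_sigma]
      refine Finset.sum_congr rfl fun i _ => ?_
      rw [Finset.sum_eq_single 0 (fun j _ hj => key g hg i j hj) (by simp)]
    · intro i hi
      exact mem_suppC.2 ⟨0, (hs _).2 hi⟩
  have hG : ∀ f ∈ geomReal K, (fun w : (i : Fin m) × Fin (n i) => if w.2 = 0 then f w.1 else 0) ∈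
      geomReal (substC K (fam 0)) := by
    intro f hf
    obtain ⟨sg, hsg, hs⟩ := gr_supp hf
    refine gr_mem (D.dS 0) ?_ ?_ (sg := Finset.univ.filter (fun w => w.1 ∈ sg ∧ w.2 = 0))
      (D.v0 0 _ (by simp) (D.dK _ hsg _ ?_)) ?_
    · intro w
      split_ifs
      · exact gr_nonneg hf _
      · exact le_rfl
    · rw [← gr_sum hf, Fintype.sum_sigma]
      refine Finset.sum_congr rfl fun i _ => ?_
      exact (Finset.sum_eq_single 0 (fun j _ hj => if_neg hj) (by simp)).trans (if_pos rfl)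
    · intro k hk
      obtain ⟨j, hj⟩ := mem_suppC.1 hk
      simp at hj
      exact hj.1
    · intro w hw
      simp at hw
      simp [hw.1, hs, hw.2]
  let F : C(geomReal (substC K (fam 0)), geomReal K) :=
    ⟨fun g => ⟨_, hF g.1 g.2⟩, Continuous.subtype_mk
      (by
        refine continuous_pi fun i => ?_
        exact (continuous_apply (⟨i, 0⟩ : (i : Fin m) × Fin (n i))).comp continuous_subtype_val) _⟩
  let G : C(geomReal K, geomReal (substC K (fam 0))) :=
    ⟨fun f => ⟨_, hG f.1 f.2⟩, Continuous.subtype_mk (by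
      refine continuous_pi fun w => ?_
      split_ifs
      · exact (continuous_apply w.1).comp continuous_subtype_val
      · exact continuous_const) _⟩
  refine ⟨⟨F, G, ?_, ?_⟩⟩
  · convert Homotopic.refl _ using 1
    ext g ⟨i, j⟩
    show g.1 ⟨i, j⟩ = if j = 0 then g.1 ⟨i, 0⟩ else 0
    split_ifs with h
    · rw [h]
    · exact key _ g.2 _ _ h
  · convert Homotopic.refl _ using 1
    ext f i
    show f.1 i = if (0 : Fin (n i)) = 0 then f.1 i else 0
    simp

end geo

section main
variable {m : ℕ} {n : Fin m → ℕ} [∀ i, NeZero (n i)] {K : Set (Finset (Fin m))}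
    {Ks : ∀ i, Set (Finset (Fin (n i)))}
    {fam : ℕ → ∀ i : Fin m, Set (Finset (Fin (n i)))}
    {Z : Fin m → Set (Finset ((i : Fin m) × Fin (n i)))}

def PP (t : ℕ) (o : Option (Fin m)) : Prop := ∀ i, o = some i → (i : ℕ) < t

theorem Dat.main (D : Dat K Ks fam Z) [hc : PathConnectedSpace ↥(geomReal K)]
    (p : ∀ o, OWedgeSpace K Z o) (t : ℕ) (ht : t ≤ m) :
    Nonempty (geomReal (substC K (fam t)) ≃ₕ WP p (PP t)) := by
  have hepK : HEP (OWedgeSpace K Z none) (p none) := hep_gr D.dK (p none)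
  have hep : ∀ o, HEP (OWedgeSpace K Z o) (p o) := by
    rintro (_ | i)
    · exact hep_gr D.dK (p none)
    · exact hep_gr (D.dZ i) (p (some i))
  have pn : ∀ t, PP t (none : Option (Fin m)) := fun t i h => by simp at h
  have jK : ∀ x : OWedgeSpace K Z none, Joined x (p none) :=
    fun x => hc.joined (X := geomReal K) x (p none)
  induction t with
  | zero =>
    obtain ⟨e1⟩ := D.base
    obtain ⟨e2⟩ := wf_unique (p := fun o : {o // PP 0 o} => p o.1) ⟨none, pn 0⟩ (by
      rintro ⟨_ | i, h⟩
      · rfl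
      · exact absurd (h i rfl) (by simp))
    exact ⟨e1.trans e2⟩
  | succ t ih =>
    obtain ⟨e⟩ := ih (by omega)
    obtain ⟨i, rfl⟩ : ∃ i : Fin m, (i : ℕ) = t := ⟨⟨t, by omega⟩, rfl⟩
    obtain ⟨e1⟩ := D.step i
    obtain ⟨e4⟩ := wf_add (p := p) (PP i) (PP (i + 1)) none (some i) (pn _)
      (fun h => absurd (h i rfl) (by simp)) (by
        rintro (_ | k)
        · simp [pn]
        · simp only [PP, Option.some.injEq, forall_eq']
          rw [Nat.lt_succ_iff_lt_or_eq, Fin.ext_iff])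
    set a := wj (fun o : {o // PP i o} => p o.1) ⟨none, pn i⟩ (p none) with ha
    obtain ⟨pz, ⟨e4⟩⟩ : ∃ pz : geomReal (Z i),
        Nonempty (Wd (WP p (PP i)) a (geomReal (Z i)) pz ≃ₕ WP p (PP (i + 1))) :=
      ⟨p (some i), ⟨e4⟩⟩
    have hz : ∀ k : Fin m, k ≠ i → ∀ l x y, Joined (X := geomReal (Z l)) x y := by
      intro k hk l x y
      obtain ⟨j, hj, hj'⟩ : ∃ j, j ≠ l ∧ {l, j} ∈ K := by
        by_cases hl : l = i
        · subst hl; exact adj D.dK D.vK l k hk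
        · exact adj D.dK D.vK l i (Ne.symm hl)
      exact (D.zjoin hj hj' x).trans (D.zjoin hj hj' y).symm
    have hj : ∀ w : WP p (PP (m := m) i), Joined w a := by
      apply wf_joined (p := fun o : {o // PP i o} => p o.1) ⟨none, pn i⟩
      rintro ⟨_ | l, h⟩ x
      · exact jK x
      · refine hz l ?_ l x (p (some l))
        rintro rfl
        exact absurd (h l rfl) (by simp)
    obtain ⟨e2⟩ := wd_congr (hep_gr (D.dZ i) ⟨dirac ⟨i, 0⟩, dirac_mem (D.dZ i) (D.vZ i)⟩) e
      ⟨dirac ⟨i, 0⟩, dirac_mem (D.dS i) (D.vS i i)⟩ a (hj _)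
    have e3 : Nonempty (Wd (WP p (PP i)) a (geomReal (Z i))
        ⟨dirac ⟨i, 0⟩, dirac_mem (D.dZ i) (D.vZ i)⟩ ≃ₕ
        Wd (WP p (PP i)) a (geomReal (Z i)) pz) := by
      by_cases hk : ∃ k : Fin m, k ≠ i
      · obtain ⟨k, hk⟩ := hk
        exact wd_congr_right (wf_hep (p := fun o : {o // PP i o} => p o.1) ⟨none, pn i⟩
          (fun o => hep o.1)) _ _ (hz k hk i _ _)
      · push Not at hk
        have hsub : Subsingleton (WP p (PP (m := m) i)) := by
          have : ∀ w : WP p (PP (m := m) i), w = a := by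
            intro w
            induction w using wf_cases with
            | h o x =>
              obtain ⟨o, h⟩ := o
              rcases o with _ | l
              · have : x = p none := by
                  have key : ∀ f g : geomReal K, f = g := by
                    intro f g
                    have hh : ∀ f : geomReal K, f.1 i = 1 := by
                      intro f
                      have := gr_sum f.2
                      rwa [Finset.sum_eq_single i (fun k _ hne => absurd (hk k) hne)
                        (by simp)] at this
                    ext k
                    rw [hk k, hh, hh]
                  exact key x (p none)
                rw [ha, this]
              · exfalso
                have := h l rfl
                rw [hk l] at this
                exact absurd this (by simp)
          exact ⟨fun x y => (this x).trans (this y).symm⟩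
        obtain ⟨f1⟩ := wd_subsingleton a (B := geomReal (Z i))
          ⟨dirac ⟨i, 0⟩, dirac_mem (D.dZ i) (D.vZ i)⟩
        obtain ⟨f2⟩ := wd_subsingleton a (B := geomReal (Z i)) pz
        exact ⟨f1.trans f2.symm⟩
    obtain ⟨e3⟩ := e3
    exact ⟨((e1.trans e2).trans e3).trans e4⟩

end main
end SubstHE

/-- homotopy decomposition of substitution complexes: let `K` be a
simplicial complex on `[m]` with path-connected realization, and `Ks i` simplicial
complexes on `[n i]`. The tower `K^0 = K`, `K^t = K^{t-1}⟨•,…,•,K_t,•,…,•⟩` is encoded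
uniformly on the vertex set `V = {(i,j) : i ∈ [m], j ∈ [n i]}`: `K^t = substC K (fam t)`,
where `fam t` substitutes `Ks i` in the blocks `i < t` and the one-vertex complex `•`
(with vertex `(i,1)`, the remaining vertices of the block being ghost vertices) in the
blocks `i ≥ t`; thus `K^0` is (the canonical copy on `V` of) `K` and
`K^m = K⟨K_1,…,K_m⟩`. With `Z i = link_{K^{i-1}}(v_i) * K_i` (the join being formed
inside `V`, where `v_i = (i,1)` is the first vertex of the `i`-th block), the geometric
realization of `K⟨K_1,…,K_m⟩` is homotopy equivalent to the wedge
`|K| ∨ |link_{K^0}(v_1) * K_1| ∨ ⋯ ∨ |link_{K^{m-1}}(v_m) * K_m|`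
(for any choice of base points, a finite wedge of path-connected spaces being independent
of the base points up to homotopy equivalence). -/
theorem substitution_homotopy_decomposition {m : ℕ} {n : Fin m → ℕ} [∀ i, NeZero (n i)]
    (K : Set (Finset (Fin m))) (hK : IsComplex K)
    (hKvert : ∀ v : Fin m, {v} ∈ K)
    (Ks : ∀ i, Set (Finset (Fin (n i)))) (hKs : ∀ i, IsComplex (Ks i))
    (hvert : ∀ i (j : Fin (n i)), ({j} : Finset (Fin (n i))) ∈ Ks i)
    (hconn : PathConnectedSpace ↥(geomReal K))
    (fam : ℕ → ∀ i : Fin m, Set (Finset (Fin (n i))))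
    (hfam : ∀ t (i : Fin m), fam t i = if (i : ℕ) < t then Ks i else {σ | σ ⊆ {0}})
    (Z : Fin m → Set (Finset ((i : Fin m) × Fin (n i))))
    (hZ : ∀ i, Z i = {σ | ∃ τ ρ, τ ∈ linkC (substC K (fam i)) ⟨i, 0⟩ ∧ ρ ∈ Ks i ∧
      σ = τ ∪ ρ.image (Sigma.mk i)})
    (p : ∀ o, OWedgeSpace K Z o) :
    Nonempty (↥(geomReal (substC K (fam m))) ≃ₕ WedgeFam (OWedgeSpace K Z) p) := by
  have D := SubstHE.mk_dat K hK hKvert Ks hKs hvert fam hfam Z hZ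
  obtain ⟨e1⟩ := SubstHE.Dat.main D p m le_rfl
  obtain ⟨e2⟩ := SubstHE.wf_all (p := p) (SubstHE.PP m) (fun o i _ => i.2)
  exact ⟨e1.trans e2⟩
end
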